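/- arXiv:2409.01796 — 2 statements merged into one kernel-verified Lean document; each statement's English description precedes it below -/
import Mathlib

section
/- Let P_n denote the path graph on n vertices. If n is even, then 2⌊n/16⌋ − 5 ≤ b^I_g(P_n) ≤ 4⌈n/16⌉ − 1. If n is odd, then 2⌊n/16⌋ ≤ b^I_g(P_n) ≤ 4⌈n/16⌉ + 4. -/
open SimpleGraph

/-- The balance score of a state `(S0, S1)` in a graph `G`: the number of edges of `G` with
one endpoint in `S0` and the other in `S1`, minus the number of edges with both endpoints
in `S0` or both endpoints in `S1`. -/
noncomputable def bscore {V : Type*} (G : SimpleGraph V) (S0 S1 : Set V) : ℤ :=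
  ({e ∈ G.edgeSet | ∃ u ∈ S0, ∃ v ∈ S1, e = s(u, v)}.ncard : ℤ) -
  ({e ∈ G.edgeSet | (∃ u ∈ S0, ∃ v ∈ S0, e = s(u, v)) ∨
      (∃ u ∈ S1, ∃ v ∈ S1, e = s(u, v))}.ncard : ℤ)

/-- The value of the balance game computed by backward induction, with `k` moves remaining.
`t = true` means it is Admirable's (the minimizer's) turn, `t = false` means it is
Impish's (the maximizer's) turn.  `S0` is the set of vertices selected by Admirable so far,
`S1` the set selected by Impish. -/
noncomputable def gameVal {V : Type*} [Fintype V] (G : SimpleGraph V) :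
    ℕ → Bool → Finset V → Finset V → ℤ
  | 0, _, S0, S1 => bscore G ↑S0 ↑S1
  | (k + 1), t, S0, S1 =>
    letI := Classical.decEq V
    if h : (Finset.univ \ (S0 ∪ S1)).Nonempty then
      if t then (Finset.univ \ (S0 ∪ S1)).inf' h fun v => gameVal G k false (insert v S0) S1
      else (Finset.univ \ (S0 ∪ S1)).sup' h fun v => gameVal G k true S0 (insert v S1)
    else bscore G ↑S0 ↑S1

/-- The (A)-start game balance number `b^A_g(G)`. -/
noncomputable def balA {V : Type*} [Fintype V] (G : SimpleGraph V) : ℤ :=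
  gameVal G (Fintype.card V) true ∅ ∅

/-- The (I)-start game balance number `b^I_g(G)`. -/
noncomputable def balI {V : Type*} [Fintype V] (G : SimpleGraph V) : ℤ :=
  gameVal G (Fintype.card V) false ∅ ∅

/-- The value of the cordiality game computed by backward induction (final score is
`|bscore|`), with `k` moves remaining; `t = true` means it is Admirable's turn. -/
noncomputable def cordVal {V : Type*} [Fintype V] (G : SimpleGraph V) :
    ℕ → Bool → Finset V → Finset V → ℤ
  | 0, _, S0, S1 => |bscore G ↑S0 ↑S1|
  | (k + 1), t, S0, S1 =>
    letI := Classical.decEq V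
    if h : (Finset.univ \ (S0 ∪ S1)).Nonempty then
      if t then (Finset.univ \ (S0 ∪ S1)).inf' h fun v => cordVal G k false (insert v S0) S1
      else (Finset.univ \ (S0 ∪ S1)).sup' h fun v => cordVal G k true S0 (insert v S1)
    else |bscore G ↑S0 ↑S1|

/-- The (A)-start game cordiality number `c^A_g(G)`. -/
noncomputable def cordA {V : Type*} [Fintype V] (G : SimpleGraph V) : ℤ :=
  cordVal G (Fintype.card V) true ∅ ∅

/-- The (I)-start game cordiality number `c^I_g(G)`. -/
noncomputable def cordI {V : Type*} [Fintype V] (G : SimpleGraph V) : ℤ :=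
  cordVal G (Fintype.card V) false ∅ ∅

namespace PathBalance

/-- A row of vertices of a path: `none` is a free vertex, `some true` a vertex of the responder and
`some false` a vertex of the opponent. -/
abbrev Strip := List (Option Bool)

/-- `v` arises from `u` by giving a free vertex to player `b`. -/
def Fill (b : Bool) (u v : Strip) : Prop :=
  ∃ l r, u = l ++ none :: r ∧ v = l ++ some b :: r

/-- `t` arises from `s` by giving a free vertex to player `b`. -/
def Play (b : Bool) (s t : Multiset Strip) : Prop :=
  ∃ u v q, Fill b u v ∧ s = u ::ₘ q ∧ t = v ::ₘ q

/-- Whether an edge with the given labels is good: if `σ = true`, its ends must belong to different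
players, and if `σ = false`, to the same player. -/
def goodEdge (σ : Bool) : Option Bool → Option Bool → ℕ
  | some x, some y => if xor x y = σ then 1 else 0
  | _, _ => 0

/-- The number of good edges of a strip. -/
def good (σ : Bool) : Strip → ℕ
  | [] => 0
  | [_] => 0
  | x :: y :: u => goodEdge σ x y + good σ (y :: u)

def total (σ : Bool) (s : Multiset Strip) : ℕ := (s.map (good σ)).sum

def free (s : Multiset Strip) : ℕ := (s.map (List.count none)).sum

/-- The responder can guarantee `c` good edges within `k` moves; the turn `true` is the
responder's. -/
def Win (σ : Bool) (c : ℕ) : ℕ → Bool → Multiset Strip → Prop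
  | 0, _, s => c ≤ total σ s
  | k + 1, true, s => ∃ t, Play true s t ∧ Win σ c k false t
  | k + 1, false, s => ∀ t, Play false s t → Win σ c k true t

lemma good_append_cons (σ : Bool) (l : Strip) (x : Option Bool) (r : Strip) :
    good σ (l ++ x :: r) = good σ (l ++ [x]) + good σ (x :: r) := by
  induction l with
  | nil => simp [good]
  | cons y l ih =>
    cases l with
    | nil => simp [good]
    | cons z l => simp only [List.cons_append, good] at ih ⊢; omega

lemma good_append_singleton_le (σ : Bool) (l : Strip) (x : Option Bool) :
    good σ l ≤ good σ (l ++ [x]) := by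
  induction l with
  | nil => simp [good]
  | cons y l ih =>
    cases l with
    | nil => simp [good]
    | cons z l => simp only [List.cons_append, good] at ih ⊢; omega

lemma good_append_le (σ : Bool) (l r : Strip) : good σ l + good σ r ≤ good σ (l ++ r) := by
  cases r with
  | nil => simp [good]
  | cons x r =>
    rw [good_append_cons]
    have := good_append_singleton_le σ l x
    omega

lemma goodEdge_comm (σ : Bool) (x y : Option Bool) : goodEdge σ x y = goodEdge σ y x := by
  cases x <;> cases y <;> simp [goodEdge, Bool.xor_comm]

lemma good_reverse (σ : Bool) (u : Strip) : good σ u.reverse = good σ u := by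
  induction u with
  | nil => rfl
  | cons x u ih =>
    cases u with
    | nil => rfl
    | cons y u =>
      rw [List.reverse_cons, List.reverse_cons, List.append_assoc, List.singleton_append,
        good_append_cons, ← List.reverse_cons, ih]
      simp [good, goodEdge_comm σ x y, add_comm]

lemma fill_append {b : Bool} {u v w : Strip} :
    Fill b (u ++ v) w ↔
      (∃ u', Fill b u u' ∧ w = u' ++ v) ∨ ∃ v', Fill b v v' ∧ w = u ++ v' := by
  constructor
  · rintro ⟨l, r, h, rfl⟩
    rcases List.append_eq_append_iff.1 h with ⟨a, rfl, rfl⟩ | ⟨a, rfl, h'⟩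
    · exact .inr ⟨_, ⟨a, r, rfl, rfl⟩, by simp⟩
    · cases a with
      | nil =>
        simp only [List.nil_append] at h'
        subst h'
        exact .inr ⟨_, ⟨[], r, rfl, rfl⟩, by simp⟩
      | cons y a =>
        simp only [List.cons_append, List.cons.injEq] at h'
        obtain ⟨rfl, rfl⟩ := h'
        exact .inl ⟨_, ⟨l, a, rfl, rfl⟩, by simp⟩
  · rintro (⟨_, ⟨l, r, rfl, rfl⟩, rfl⟩ | ⟨_, ⟨l, r, rfl, rfl⟩, rfl⟩)
    · exact ⟨l, r ++ v, by simp, by simp⟩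
    · exact ⟨u ++ l, r, by simp, by simp⟩

lemma Fill.none_mem {b : Bool} {u v : Strip} (h : Fill b u v) : none ∈ u := by
  obtain ⟨l, r, rfl, rfl⟩ := h
  simp

lemma not_fill {b : Bool} {u v : Strip} (h : none ∉ u) : ¬ Fill b u v := fun h' => h h'.none_mem

lemma fill_reverse {b : Bool} {u v : Strip} : Fill b u.reverse v.reverse ↔ Fill b u v := by
  have key : ∀ {u v : Strip}, Fill b u v → Fill b u.reverse v.reverse := by
    rintro _ _ ⟨l, r, rfl, rfl⟩
    exact ⟨r.reverse, l.reverse, by simp, by simp⟩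
  exact ⟨fun h => by simpa using key h, key⟩

lemma fill_replicate {b : Bool} {m : ℕ} {v : Strip} :
    Fill b (List.replicate m none) v ↔
      ∃ r < m, v = List.replicate r none ++ some b :: List.replicate (m - 1 - r) none := by
  constructor
  · rintro ⟨l, r, h, rfl⟩
    obtain ⟨hlen, hl, hr⟩ := List.append_eq_replicate_iff.1 h.symm
    simp only [List.length_cons] at hlen hr
    rw [List.replicate_succ, List.cons.injEq] at hr
    refine ⟨l.length, by omega, ?_⟩
    rw [← hl, show m - 1 - l.length = r.length by omega, ← hr.2]
  · rintro ⟨r, hr, rfl⟩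
    refine ⟨_, _, ?_, rfl⟩
    rw [← List.replicate_succ, ← List.replicate_add,
      show r + (m - 1 - r + 1) = m by omega]

lemma play_singleton {b : Bool} {u : Strip} {t : Multiset Strip} :
    Play b {u} t ↔ ∃ v, Fill b u v ∧ t = {v} := by
  constructor
  · rintro ⟨u', v, q, h, hs, rfl⟩
    obtain ⟨rfl, rfl⟩ := (Multiset.singleton_eq_cons_iff _).1 hs
    exact ⟨v, h, rfl⟩
  · rintro ⟨v, h, rfl⟩
    exact ⟨u, v, 0, h, rfl, rfl⟩

lemma play_zero {b : Bool} {t : Multiset Strip} : ¬ Play b 0 t := by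
  rintro ⟨u, v, q, -, h, -⟩
  exact Multiset.zero_ne_cons h

lemma Play.add_right {b : Bool} {s s' : Multiset Strip} (h : Play b s s') (t : Multiset Strip) :
    Play b (s + t) (s' + t) := by
  obtain ⟨u, v, q, h, rfl, rfl⟩ := h
  exact ⟨u, v, q + t, h, by simp, by simp⟩

lemma Play.add_left {b : Bool} {t t' : Multiset Strip} (h : Play b t t') (s : Multiset Strip) :
    Play b (s + t) (s + t') := by
  rw [add_comm s t, add_comm s t']
  exact h.add_right s

lemma play_add {b : Bool} {s t w : Multiset Strip} :
    Play b (s + t) w ↔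
      (∃ s', Play b s s' ∧ w = s' + t) ∨ ∃ t', Play b t t' ∧ w = s + t' := by
  constructor
  · rintro ⟨u, v, q, h, hs, rfl⟩
    have hu : u ∈ s + t := hs ▸ Multiset.mem_cons_self u q
    rcases Multiset.mem_add.1 hu with hu | hu
    · obtain ⟨s, rfl⟩ := Multiset.exists_cons_of_mem hu
      rw [Multiset.cons_add, Multiset.cons_inj_right] at hs
      exact .inl ⟨v ::ₘ s, ⟨u, v, s, h, rfl, rfl⟩, by rw [← hs, Multiset.cons_add]⟩
    · obtain ⟨t, rfl⟩ := Multiset.exists_cons_of_mem hu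
      rw [Multiset.add_cons, Multiset.cons_inj_right] at hs
      exact .inr ⟨v ::ₘ t, ⟨u, v, t, h, rfl, rfl⟩, by rw [← hs, Multiset.add_cons]⟩
  · rintro (⟨s', h, rfl⟩ | ⟨t', h, rfl⟩)
    · exact h.add_right t
    · exact h.add_left s

lemma total_add (σ : Bool) (s t : Multiset Strip) : total σ (s + t) = total σ s + total σ t := by
  simp [total]

lemma total_singleton (σ : Bool) (u : Strip) : total σ {u} = good σ u := by simp [total]

lemma free_add (s t : Multiset Strip) : free (s + t) = free s + free t := by simp [free]

lemma free_singleton (u : Strip) : free {u} = u.count none := by simp [free]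

lemma Play.free_eq {b : Bool} {s t : Multiset Strip} (h : Play b s t) : free s = free t + 1 := by
  obtain ⟨_, _, q, ⟨l, r, rfl, rfl⟩, rfl, rfl⟩ := h
  simp [free]
  omega

lemma exists_play (b : Bool) {s : Multiset Strip} (h : free s ≠ 0) : ∃ t, Play b s t := by
  obtain ⟨u, hu, hn⟩ : ∃ u ∈ s, none ∈ u := by
    by_contra! hs
    refine h (Multiset.sum_eq_zero ?_)
    simpa [List.count_eq_zero] using hs
  obtain ⟨q, rfl⟩ := Multiset.exists_cons_of_mem hu
  obtain ⟨l, r, rfl⟩ := List.append_of_mem hn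
  exact ⟨_, _, _, q, ⟨l, r, rfl, rfl⟩, rfl, rfl⟩

lemma Win.mono {σ : Bool} {c d : ℕ} (h : d ≤ c) {k : ℕ} {b : Bool} {s : Multiset Strip}
    (hw : Win σ c k b s) : Win σ d k b s := by
  induction k generalizing b s with
  | zero => exact h.trans hw
  | succ k ih =>
    cases b with
    | true => exact hw.imp fun t ht => ⟨ht.1, ih ht.2⟩
    | false => exact fun t ht => ih (hw t ht)

lemma win_zero (σ : Bool) {k : ℕ} {s : Multiset Strip} (hk : Even k) (hs : free s = k) :
    Win σ 0 k false s := by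
  obtain ⟨m, rfl⟩ := hk
  induction m generalizing s with
  | zero => exact Nat.zero_le _
  | succ m ih =>
    rw [show m + 1 + (m + 1) = m + m + 1 + 1 by ring] at hs ⊢
    intro t ht
    have h := ht.free_eq
    obtain ⟨t', ht'⟩ := exists_play true (s := t) (by omega)
    have h' := ht'.free_eq
    exact ⟨t', ht', ih (by omega)⟩

/-- The responder can play two boards independently. -/
lemma Win.add {σ : Bool} {c d k l : ℕ} {s t : Multiset Strip} (hk : Even k) (hl : Even l)
    (hsk : free s = k) (htl : free t = l) (hs : Win σ c k false s) (ht : Win σ d l false t) :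
    Win σ (c + d) (k + l) false (s + t) := by
  obtain ⟨n, hn⟩ : ∃ n, k + l = n := ⟨_, rfl⟩
  induction n using Nat.strong_induction_on generalizing k l s t with
  | _ n ih =>
    obtain rfl | h0 := Nat.eq_zero_or_pos n
    · obtain ⟨rfl, rfl⟩ : k = 0 ∧ l = 0 := by omega
      exact (add_le_add hs ht).trans_eq (total_add σ s t).symm
    · obtain ⟨n, rfl⟩ : ∃ m, n = m + 2 := ⟨n - 2, by grind⟩
      rw [hn]
      intro w hw
      rcases play_add.1 hw with ⟨s', h, rfl⟩ | ⟨t', h, rfl⟩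
      · have hf := h.free_eq
        obtain ⟨k, rfl⟩ : ∃ m, k = m + 2 := ⟨k - 2, by grind⟩
        obtain ⟨s'', h', hs''⟩ := hs _ h
        have hf' := h'.free_eq
        refine ⟨s'' + t, h'.add_right t, ?_⟩
        have := ih n (by omega) (k := k) (by grind) hl (by omega) htl hs'' ht (by omega)
        rwa [show k + l = n by omega] at this
      · have hf := h.free_eq
        obtain ⟨l, rfl⟩ : ∃ m, l = m + 2 := ⟨l - 2, by grind⟩
        obtain ⟨t'', h', ht''⟩ := ht _ h
        have hf' := h'.free_eq
        refine ⟨s + t'', h'.add_left s, ?_⟩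
        have := ih n (by omega) (l := l) hk (by grind) hsk (by omega) hs ht'' (by omega)
        rwa [show k + l = n by omega] at this

/-- A guarantee is inherited along a bisimulation `R`, applied to a part of the board. -/
lemma Win.of_bisim {σ : Bool} {d : ℕ} {R : Multiset Strip → Multiset Strip → Prop}
    (hst : ∀ b s t s', R s t → Play b s s' → ∃ t', Play b t t' ∧ R s' t')
    (hts : ∀ b s t t', R s t → Play b t t' → ∃ s', Play b s s' ∧ R s' t')
    (hR : ∀ s t, R s t → total σ t + d ≤ total σ s)
    {c k : ℕ} {b : Bool} {s t q : Multiset Strip} (h : R s t) (hw : Win σ c k b (t + q)) :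
    Win σ (c + d) k b (s + q) := by
  induction k generalizing b s t q with
  | zero =>
    have h1 := hR s t h
    have h2 : c ≤ total σ (t + q) := hw
    change c + d ≤ total σ (s + q)
    rw [total_add] at *
    omega
  | succ k ih =>
    cases b with
    | true =>
      obtain ⟨w, hw, hw'⟩ := hw
      rcases play_add.1 hw with ⟨t', ht, rfl⟩ | ⟨q', hq, rfl⟩
      · obtain ⟨s', hs, h'⟩ := hts _ _ _ _ h ht
        exact ⟨_, hs.add_right q, ih h' hw'⟩
      · exact ⟨_, hq.add_left s, ih h hw'⟩
    | false =>
      intro w hw'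
      rcases play_add.1 hw' with ⟨s', hs, rfl⟩ | ⟨q', hq, rfl⟩
      · obtain ⟨t', ht, h'⟩ := hst _ _ _ _ h hs
        exact ih h' (hw _ (ht.add_right q))
      · exact ih h (hw _ (hq.add_left t))

lemma Win.of_cut {σ : Bool} {c k : ℕ} {b : Bool} {l r : Strip} {q : Multiset Strip}
    (hw : Win σ c k b ({l} + {r} + q)) : Win σ c k b ({l ++ r} + q) := by
  refine Win.of_bisim (d := 0) (R := fun s t => ∃ l r : Strip, s = {l ++ r} ∧ t = {l} + {r})
    ?_ ?_ ?_ ⟨l, r, rfl, rfl⟩ hw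
  · rintro b _ _ s' ⟨l, r, rfl, rfl⟩ h
    obtain ⟨v, hv, rfl⟩ := play_singleton.1 h
    rcases fill_append.1 hv with ⟨l', h', rfl⟩ | ⟨r', h', rfl⟩
    · exact ⟨_, (play_singleton.2 ⟨l', h', rfl⟩).add_right _, l', r, rfl, rfl⟩
    · exact ⟨_, (play_singleton.2 ⟨r', h', rfl⟩).add_left _, l, r', rfl, rfl⟩
  · rintro b _ _ t' ⟨l, r, rfl, rfl⟩ h
    rcases play_add.1 h with ⟨s, h', rfl⟩ | ⟨s, h', rfl⟩ <;>
      obtain ⟨v, hv, rfl⟩ := play_singleton.1 h'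
    · exact ⟨_, play_singleton.2 ⟨_, fill_append.2 (.inl ⟨v, hv, rfl⟩), rfl⟩, v, r, rfl, rfl⟩
    · exact ⟨_, play_singleton.2 ⟨_, fill_append.2 (.inr ⟨v, hv, rfl⟩), rfl⟩, l, v, rfl, rfl⟩
  · rintro _ _ ⟨l, r, rfl, rfl⟩
    simpa [total] using good_append_le σ l r

lemma fill_concat_some {b x : Bool} {l v : Strip} :
    Fill b (l ++ [some x]) v ↔ ∃ l', Fill b l l' ∧ v = l' ++ [some x] := by
  rw [fill_append]
  simp [not_fill]

lemma fill_some_cons {b x : Bool} {r v : Strip} :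
    Fill b (some x :: r) v ↔ ∃ r', Fill b r r' ∧ v = some x :: r' := by
  rw [← List.singleton_append, fill_append]
  simp [not_fill]

lemma Win.of_cut_some {σ : Bool} {c k : ℕ} {b x : Bool} {l r : Strip} {q : Multiset Strip}
    (hw : Win σ c k b ({l ++ [some x]} + {some x :: r} + q)) :
    Win σ c k b ({l ++ some x :: r} + q) := by
  refine Win.of_bisim (d := 0) (R := fun s t => ∃ l r : Strip, s = {l ++ some x :: r} ∧
    t = {l ++ [some x]} + {some x :: r}) ?_ ?_ ?_ ⟨l, r, rfl, rfl⟩ hw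
  · rintro b _ _ s' ⟨l, r, rfl, rfl⟩ h
    obtain ⟨v, hv, rfl⟩ := play_singleton.1 h
    rcases fill_append.1 hv with ⟨l', h', rfl⟩ | ⟨r', h', rfl⟩
    · exact ⟨_, (play_singleton.2 ⟨_, fill_concat_some.2 ⟨l', h', rfl⟩, rfl⟩).add_right _,
        l', r, rfl, rfl⟩
    · obtain ⟨r', h'', rfl⟩ := fill_some_cons.1 h'
      exact ⟨_, (play_singleton.2 ⟨_, fill_some_cons.2 ⟨r', h'', rfl⟩, rfl⟩).add_left _,
        l, r', rfl, rfl⟩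
  · rintro b _ _ t' ⟨l, r, rfl, rfl⟩ h
    rcases play_add.1 h with ⟨s, h', rfl⟩ | ⟨s, h', rfl⟩ <;>
      obtain ⟨v, hv, rfl⟩ := play_singleton.1 h'
    · obtain ⟨v, h'', rfl⟩ := fill_concat_some.1 hv
      exact ⟨_, play_singleton.2 ⟨_, fill_append.2 (.inl ⟨v, h'', rfl⟩), rfl⟩, v, r, rfl, rfl⟩
    · obtain ⟨v, h'', rfl⟩ := fill_some_cons.1 hv
      exact ⟨_, play_singleton.2 ⟨_, fill_append.2 (.inr ⟨_, hv, rfl⟩), rfl⟩, l, v, rfl, rfl⟩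
  · rintro _ _ ⟨l, r, rfl, rfl⟩
    simp [total, good_append_cons σ l (some x) r]

lemma Win.of_reverse {σ : Bool} {c k : ℕ} {b : Bool} {u : Strip} {q : Multiset Strip}
    (hw : Win σ c k b ({u.reverse} + q)) : Win σ c k b ({u} + q) := by
  refine Win.of_bisim (d := 0) (R := fun s t => ∃ u : Strip, s = {u} ∧ t = {u.reverse})
    ?_ ?_ ?_ ⟨u, rfl, rfl⟩ hw
  · rintro b _ _ s' ⟨u, rfl, rfl⟩ h
    obtain ⟨v, hv, rfl⟩ := play_singleton.1 h
    exact ⟨_, play_singleton.2 ⟨_, fill_reverse.2 hv, rfl⟩, v, rfl, rfl⟩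
  · rintro b _ _ t' ⟨u, rfl, rfl⟩ h
    obtain ⟨v, hv, rfl⟩ := play_singleton.1 h
    refine ⟨_, play_singleton.2 ⟨v.reverse, fill_reverse.1 ?_, rfl⟩, _, rfl, ?_⟩ <;> simp [hv]
  · rintro _ _ ⟨u, rfl, rfl⟩
    simp [total, good_reverse]

lemma Win.of_drop {σ : Bool} {c k : ℕ} {b : Bool} {u : Strip} {q : Multiset Strip}
    (hu : none ∉ u) (hw : Win σ c k b q) : Win σ (c + good σ u) k b ({u} + q) := by
  refine Win.of_bisim (R := fun s t => s = {u} ∧ t = 0) (t := 0) ?_ ?_ ?_ ⟨rfl, rfl⟩ (by simpa)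
  · rintro b _ _ s' ⟨rfl, rfl⟩ h
    obtain ⟨v, hv, rfl⟩ := play_singleton.1 h
    exact absurd hv (not_fill hu)
  · rintro b _ _ t' ⟨rfl, rfl⟩ h
    exact absurd h play_zero
  · rintro _ _ ⟨rfl, rfl⟩
    simp [total]

/-- A segment of `m` free vertices with boundary codes `a` and `b` (`0` is an end of the path, `1` a
vertex of the responder, `2` a vertex of the opponent) is coded by `9 * m + 3 * a + b`, where the
smaller boundary code comes first. -/
def enc (a m b : ℕ) : ℕ := bif a.ble b then 9 * m + 3 * a + b else 9 * m + 3 * b + a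

/-- The list of the coded segment with `m` free vertices, which is empty if `m = 0`. -/
def seg (a m b : ℕ) : List ℕ := bif m.beq 0 then [] else [enc a m b]

/-- The number of good edges between vertices with boundary codes `a` and `b`. -/
def edgeCode (σ : Bool) (a b : ℕ) : ℕ :=
  bif (a * b).beq 0 then 0 else bif xor (a.beq b) σ then 1 else 0

def gain (σ : Bool) (a m b : ℕ) : ℕ := bif m.beq 0 then edgeCode σ a b else 0

/-- The outcome of giving code `x` to the `r`-th free vertex of a list of coded segments: the new
segments and the number of good edges that are completed by the move. -/
def playAt (σ : Bool) (x : ℕ) : List ℕ → ℕ → List ℕ × ℕ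
  | [], _ => ([], 0)
  | c :: l, r =>
    bif r.blt (c / 9) then
      (seg (c / 3 % 3) r x ++ (seg x (c / 9 - 1 - r) (c % 3) ++ l),
        gain σ (c / 3 % 3) r x + gain σ x (c / 9 - 1 - r) (c % 3))
    else (c :: (playAt σ x l (r - c / 9)).1, (playAt σ x l (r - c / 9)).2)

/-- The number of free vertices in a list of coded segments. -/
def codeFree : List ℕ → ℕ
  | [] => 0
  | c :: l => c / 9 + codeFree l

def insertCode (c : ℕ) : List ℕ → List ℕ
  | [] => [c]
  | d :: l => bif c.ble d then c :: d :: l else d :: insertCode c l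

def sortCodes : List ℕ → List ℕ
  | [] => []
  | c :: l => insertCode c (sortCodes l)

/-- Search trees of certified positions: each node holds the key of a list of coded segments, a
number of good edges that the responder can guarantee, and the replies to the opponent's moves, as
digits in base `65536`. -/
inductive Table
  | nil
  | node (k t h : ℕ) (a b : Table)

def key : List ℕ → ℕ
  | [] => 0
  | c :: l => key l * 256 + c

def ofKey : ℕ → ℕ → List ℕ
  | 0, _ => []
  | f + 1, k => bif k.beq 0 then [] else k % 256 :: ofKey f (k / 256)

def eqCodes : List ℕ → List ℕ → Bool
  | [], [] => true
  | c :: l, d :: l' => c.beq d && eqCodes l l'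
  | _, _ => false

def Table.find (k : ℕ) (l : List ℕ) : Table → ℕ
  | nil => 0
  | node k' t _ a b =>
    bif k.blt k' then a.find k l else bif k'.blt k then b.find k l else
      bif eqCodes l (ofKey 5 k') then t else 0

/-- The segments whose group number is `i`, where the base `4` digits of `g` are the group
numbers. -/
def group (i : ℕ) : ℕ → List ℕ → List ℕ
  | _, [] => []
  | g, c :: l => bif (g % 4).beq i then c :: group i (g / 4) l else group i (g / 4) l

/-- Whether the groups `i - 1, …, 0` guarantee `t` good edges by the table. -/
def groupsCover (T : Table) (g : ℕ) (l : List ℕ) : ℕ → ℕ → Bool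
  | 0, t => t.beq 0
  | i + 1, t => t.beq 0 ||
    match group i g l with
    | [] => groupsCover T g l i t
    | c :: l' =>
      match T.find (key (c :: l')) (c :: l') with
      | 0 => false
      | v + 1 => groupsCover T g l i (t - (v + 1))

/-- Whether the reply coded by `h` to the outcome `p` of a move leaves groups that, with the
completed edges, guarantee `t` good edges. -/
def replyCheck (σ : Bool) (T : Table) (t h : ℕ) (p : List ℕ × ℕ) : Bool :=
  (h % 16).blt (codeFree p.1) &&
    groupsCover T (h / 16) (sortCodes (playAt σ 1 p.1 (h % 16)).1) 4
      (t - p.2 - (playAt σ 1 p.1 (h % 16)).2)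

def entryCheck (σ : Bool) (T : Table) (t h : ℕ) (l : List ℕ) : Bool :=
  Nat.blt 0 (codeFree l) && (codeFree l % 2).beq 0 && (List.range (codeFree l)).all fun v =>
    replyCheck σ T t (h / 65536 ^ v % 65536) (playAt σ 2 l v)

def Table.check (σ : Bool) (T : Table) : Table → Bool
  | .nil => true
  | .node k t h a b =>
    entryCheck σ T t h (ofKey 5 k) && check σ T a && check σ T b

/-- The label of a boundary code. -/
def ends : ℕ → Strip
  | 0 => []
  | 1 => [some true]
  | _ => [some false]

def code (b : Bool) : ℕ := bif b then 1 else 2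

def segStrip (a m b : ℕ) : Strip := ends a ++ List.replicate m none ++ ends b

/-- The strip of a coded segment. -/
def strip (c : ℕ) : Strip := segStrip (c / 3 % 3) (c / 9) (c % 3)

def strips (l : List ℕ) : Multiset Strip := (l.map strip : List Strip)

lemma strips_nil : strips [] = 0 := rfl

lemma strips_cons (c : ℕ) (l : List ℕ) : strips (c :: l) = {strip c} + strips l := by
  simp [strips]

lemma strips_append (l l' : List ℕ) : strips (l ++ l') = strips l + strips l' := by
  simp [strips]

lemma ends_code (b : Bool) : ends (code b) = [some b] := by cases b <;> rfl

lemma code_lt (b : Bool) : code b < 3 := by cases b <;> decide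

lemma none_notMem_ends (a : ℕ) : none ∉ ends a := by
  unfold ends
  split <;> simp

lemma ends_reverse (a : ℕ) : (ends a).reverse = ends a := by
  unfold ends
  split <;> rfl

lemma segStrip_reverse (a m b : ℕ) : (segStrip a m b).reverse = segStrip b m a := by
  simp [segStrip, ends_reverse]

lemma count_segStrip (a m b : ℕ) : (segStrip a m b).count none = m := by
  simp [segStrip, List.count_eq_zero.2 (none_notMem_ends _)]

lemma strip_enc {a b : ℕ} (ha : a < 3) (hb : b < 3) (m : ℕ) :
    strip (enc a m b) = segStrip a m b ∨ strip (enc a m b) = segStrip b m a := by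
  unfold enc strip
  cases a.ble b
  · right
    simp only [cond_false]
    rw [show (9 * m + 3 * b + a) / 3 % 3 = b by omega, show (9 * m + 3 * b + a) / 9 = m by omega,
      show (9 * m + 3 * b + a) % 3 = a by omega]
  · left
    simp only [cond_true]
    rw [show (9 * m + 3 * a + b) / 3 % 3 = a by omega, show (9 * m + 3 * a + b) / 9 = m by omega,
      show (9 * m + 3 * a + b) % 3 = b by omega]

lemma enc_div {a b : ℕ} (ha : a < 3) (hb : b < 3) (m : ℕ) : enc a m b / 9 = m := by
  unfold enc
  cases a.ble b <;> simp only [cond_false, cond_true] <;> omega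

lemma good_ends_append (σ : Bool) {a b : ℕ} (ha : a < 3) (hb : b < 3) :
    good σ (ends a ++ ends b) = edgeCode σ a b := by
  cases σ <;> interval_cases a <;> interval_cases b <;> rfl

lemma Win.of_seg {σ : Bool} {c k : ℕ} {t : Bool} {q : Multiset Strip} {a b : ℕ} (ha : a < 3)
    (hb : b < 3) (m : ℕ) (hw : Win σ c k t (strips (seg a m b) + q)) :
    Win σ (c + gain σ a m b) k t ({segStrip a m b} + q) := by
  cases m with
  | zero =>
    have h := hw.of_drop (u := segStrip a 0 b) (by simp [segStrip, none_notMem_ends])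
    simpa [segStrip, good_ends_append σ ha hb, gain, seg, strips_nil] using h
  | succ m =>
    have hw : Win σ c k t ({strip (enc a (m + 1) b)} + q) := hw
    rcases strip_enc ha hb (m + 1) with h | h <;> rw [h] at hw
    · exact hw
    · rw [← segStrip_reverse] at hw
      exact hw.of_reverse

lemma codeFree_append (l l' : List ℕ) : codeFree (l ++ l') = codeFree l + codeFree l' := by
  induction l with
  | nil => simp [codeFree]
  | cons c l ih => simp [codeFree, ih, add_assoc]

lemma codeFree_seg {a b : ℕ} (ha : a < 3) (hb : b < 3) (m : ℕ) : codeFree (seg a m b) = m := by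
  cases m with
  | zero => rfl
  | succ m =>
    change enc a (m + 1) b / 9 + 0 = m + 1
    rw [enc_div ha hb, add_zero]

lemma free_strips (l : List ℕ) : free (strips l) = codeFree l := by
  induction l with
  | nil => rfl
  | cons c l ih => rw [strips_cons, free_add, free_singleton, strip, count_segStrip, ih, codeFree]

lemma codeFree_perm {l l' : List ℕ} (h : l.Perm l') : codeFree l = codeFree l' := by
  rw [← free_strips, ← free_strips, strips, strips, Multiset.coe_eq_coe.2 (h.map _)]

lemma strips_perm {l l' : List ℕ} (h : l.Perm l') : strips l = strips l' :=
  Multiset.coe_eq_coe.2 (h.map _)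

/-- The board after player `b` has filled the `r`-th free vertex of a list of segments. -/
def outcome (b : Bool) : List ℕ → ℕ → Multiset Strip
  | [], _ => 0
  | c :: l, r =>
    if r < c / 9 then
      {ends (c / 3 % 3) ++ List.replicate r none ++ some b ::
        (List.replicate (c / 9 - 1 - r) none ++ ends (c % 3))} + strips l
    else {strip c} + outcome b l (r - c / 9)

lemma fill_segStrip {b : Bool} {a m a' : ℕ} {v : Strip} :
    Fill b (segStrip a m a') v ↔ ∃ r < m, v = ends a ++ List.replicate r none ++ some b ::
      (List.replicate (m - 1 - r) none ++ ends a') := by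
  simp only [segStrip, fill_append, not_fill (none_notMem_ends _), fill_replicate]
  constructor
  · rintro (⟨_, (⟨_, ⟨⟩, _⟩ | ⟨_, ⟨r, hr, rfl⟩, rfl⟩), rfl⟩ | ⟨_, ⟨⟩, _⟩)
    exact ⟨r, hr, by simp⟩
  · rintro ⟨r, hr, rfl⟩
    exact .inl ⟨_, .inr ⟨_, ⟨r, hr, rfl⟩, rfl⟩, by simp⟩

lemma play_strips {b : Bool} {l : List ℕ} {t : Multiset Strip} :
    Play b (strips l) t ↔ ∃ r < codeFree l, t = outcome b l r := by
  induction l generalizing t with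
  | nil => simp [strips_nil, play_zero, codeFree]
  | cons c l ih =>
    simp only [strips_cons, play_add, play_singleton, strip, fill_segStrip, codeFree, outcome, ih]
    constructor
    · rintro (⟨_, ⟨_, ⟨r, hr, rfl⟩, rfl⟩, rfl⟩ | ⟨_, ⟨r, hr, rfl⟩, rfl⟩)
      · exact ⟨r, by omega, by rw [if_pos hr]⟩
      · exact ⟨c / 9 + r, by omega, by rw [if_neg (by omega), Nat.add_sub_cancel_left]⟩
    · rintro ⟨r, hr, rfl⟩
      split_ifs with h
      · exact .inl ⟨_, ⟨_, ⟨r, h, rfl⟩, rfl⟩, rfl⟩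
      · exact .inr ⟨_, ⟨r - c / 9, by omega, rfl⟩, rfl⟩

lemma Win.of_playAt {σ : Bool} {c k : ℕ} {t : Bool} (b : Bool) {l : List ℕ} {r : ℕ}
    {q : Multiset Strip} (hr : r < codeFree l)
    (hw : Win σ c k t (strips (playAt σ (code b) l r).1 + q)) :
    Win σ (c + (playAt σ (code b) l r).2) k t (outcome b l r + q) := by
  induction l generalizing r q with
  | nil => simp [codeFree] at hr
  | cons x l ih =>
    have h1 : x / 3 % 3 < 3 := Nat.mod_lt _ (by decide)
    have h2 : x % 3 < 3 := Nat.mod_lt _ (by decide)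
    have hb := code_lt b
    simp only [playAt, outcome] at hw ⊢
    by_cases h : r < x / 9
    · have hlt : r.blt (x / 9) = true := by simpa [Nat.blt_eq] using h
      rw [hlt] at hw ⊢
      simp only [cond_true, if_pos h, strips_append] at hw ⊢
      rw [add_assoc]
      apply Win.of_cut_some
      rw [show some b :: (List.replicate (x / 9 - 1 - r) none ++ ends (x % 3)) =
        segStrip (code b) (x / 9 - 1 - r) (x % 3) by simp [segStrip, ends_code],
        show ends (x / 3 % 3) ++ List.replicate r none ++ [some b] =
        segStrip (x / 3 % 3) r (code b) by simp [segStrip, ends_code]]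
      rw [add_comm (gain _ _ _ _), ← add_assoc, add_assoc {_}]
      refine Win.of_seg h1 hb r ?_
      rw [add_left_comm]
      refine Win.of_seg hb h2 _ ?_
      rw [add_left_comm]
      simpa only [add_assoc] using hw
    · have hlt : r.blt (x / 9) = false := by
        rw [← Bool.not_eq_true, Nat.blt_eq]
        exact h
      rw [hlt] at hw ⊢
      simp only [cond_false, if_neg h, strips_cons] at hw ⊢
      rw [codeFree] at hr
      rw [add_comm {_}, add_assoc]
      refine ih (by omega) ?_
      rw [← add_assoc, add_comm (strips _)]
      exact hw

lemma codeFree_playAt (σ b : Bool) {l : List ℕ} {r : ℕ} (hr : r < codeFree l) :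
    codeFree (playAt σ (code b) l r).1 + 1 = codeFree l := by
  induction l generalizing r with
  | nil => simp [codeFree] at hr
  | cons x l ih =>
    have h1 : x / 3 % 3 < 3 := Nat.mod_lt _ (by decide)
    have h2 : x % 3 < 3 := Nat.mod_lt _ (by decide)
    have hb := code_lt b
    simp only [playAt]
    by_cases h : r < x / 9
    · have hlt : r.blt (x / 9) = true := by simpa [Nat.blt_eq] using h
      simp only [hlt, cond_true, codeFree_append, codeFree_seg, codeFree, h1, h2, hb]
      omega
    · have hlt : r.blt (x / 9) = false := by
        rw [← Bool.not_eq_true, Nat.blt_eq]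
        exact h
      rw [codeFree] at hr
      have := ih (r := r - x / 9) (by omega)
      simp only [hlt, cond_false, codeFree]
      omega

lemma insertCode_perm (c : ℕ) (l : List ℕ) : (insertCode c l).Perm (c :: l) := by
  induction l with
  | nil => rfl
  | cons d l ih =>
    unfold insertCode
    cases c.ble d
    · exact (ih.cons d).trans (.swap c d l)
    · rfl

lemma sortCodes_perm (l : List ℕ) : (sortCodes l).Perm l := by
  induction l with
  | nil => rfl
  | cons c l ih => exact (insertCode_perm c _).trans (ih.cons c)

lemma eq_of_eqCodes {l l' : List ℕ} (h : eqCodes l l' = true) : l = l' := by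
  induction l generalizing l' with
  | nil => cases l' <;> simp_all [eqCodes]
  | cons c l ih =>
    cases l' with
    | nil => simp [eqCodes] at h
    | cons d l' =>
      simp only [eqCodes, Bool.and_eq_true, Nat.beq_eq] at h
      rw [h.1, ih h.2]

lemma Table.check_find {σ : Bool} {T T' : Table} (hT : Table.check σ T T' = true) {k : ℕ}
    {l : List ℕ} (h : T'.find k l ≠ 0) : ∃ r, entryCheck σ T (T'.find k l) r l = true := by
  induction T' with
  | nil => exact absurd rfl h
  | node k' t r a b iha ihb =>
    rw [Table.check, Bool.and_eq_true, Bool.and_eq_true] at hT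
    unfold Table.find at h ⊢
    cases h1 : k.blt k'
    · cases h2 : k'.blt k
      · cases h3 : eqCodes l (ofKey 5 k')
        · simp [h1, h2, h3] at h
        · simp only [cond_false, cond_true]
          rw [eq_of_eqCodes h3]
          exact ⟨r, hT.1.1⟩
      · simp only [h1, h2, cond_false, cond_true] at h ⊢
        exact ihb hT.2 h
    · simp only [h1, cond_true] at h ⊢
      exact iha hT.1.2 h

/-- The segments whose group number is less than `i`. -/
def groupsBelow (i : ℕ) : ℕ → List ℕ → List ℕ
  | _, [] => []
  | g, c :: l => if g % 4 < i then c :: groupsBelow i (g / 4) l else groupsBelow i (g / 4) l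

lemma groupsBelow_succ_perm (i g : ℕ) (l : List ℕ) :
    (groupsBelow (i + 1) g l).Perm (group i g l ++ groupsBelow i g l) := by
  induction l generalizing g with
  | nil => rfl
  | cons c l ih =>
    have := ih (g / 4)
    simp only [groupsBelow, group]
    rcases lt_trichotomy (g % 4) i with h | h | h
    · have hb : (g % 4).beq i = false := by rw [← Bool.not_eq_true, Nat.beq_eq]; omega
      rw [if_pos (by omega), if_pos h, hb, cond_false]
      exact (this.cons c).trans List.perm_middle.symm
    · have hb : (g % 4).beq i = true := by rw [Nat.beq_eq]; omega
      rw [if_pos (by omega), if_neg (by omega), hb, cond_true]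
      exact this.cons c
    · have hb : (g % 4).beq i = false := by rw [← Bool.not_eq_true, Nat.beq_eq]; omega
      rw [if_neg (by omega), if_neg (by omega), hb, cond_false]
      exact this

lemma groupsBelow_four (g : ℕ) (l : List ℕ) : groupsBelow 4 g l = l := by
  induction l generalizing g with
  | nil => rfl
  | cons c l ih => rw [groupsBelow, if_pos (Nat.mod_lt _ (by decide)), ih]

lemma even_of_entryCheck {σ : Bool} {T : Table} {t h : ℕ} {l : List ℕ}
    (hc : entryCheck σ T t h l = true) : Even (codeFree l) := by
  simp only [entryCheck, Bool.and_eq_true, Nat.beq_eq] at hc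
  exact Nat.even_iff.2 hc.1.2

lemma win_groupsBelow {σ : Bool} {T : Table} (hT : Table.check σ T T = true) {n : ℕ}
    (ih : ∀ l t h, codeFree l < n → entryCheck σ T t h l = true →
      Win σ t (codeFree l) false (strips l))
    {g : ℕ} {l : List ℕ} {i t : ℕ} (hc : groupsCover T g l i t = true)
    (he : Even (codeFree (groupsBelow i g l))) (hn : codeFree (groupsBelow i g l) < n) :
    Win σ t (codeFree (groupsBelow i g l)) false (strips (groupsBelow i g l)) := by
  induction i generalizing t with
  | zero =>
    simp only [groupsCover, Nat.beq_eq] at hc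
    subst hc
    exact win_zero σ he (free_strips _)
  | succ i ihi =>
    by_cases ht : t = 0
    · subst ht
      exact win_zero σ he (free_strips _)
    have ht' : t.beq 0 = false := by rw [← Bool.not_eq_true, Nat.beq_eq]; exact ht
    have hp := groupsBelow_succ_perm i g l
    have hfree := codeFree_perm hp
    rw [codeFree_append] at hfree
    rw [strips_perm hp, strips_append, hfree]
    rw [hfree] at he hn
    rw [groupsCover, ht', Bool.false_or] at hc
    split at hc
    · next hg =>
      rw [hg] at he hn ⊢
      simp only [codeFree, zero_add, strips_nil] at he hn ⊢
      exact ihi hc he hn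
    · next c l' hg =>
      rw [← hg] at hc
      split at hc
      · cases hc
      · next v hv =>
        obtain ⟨r, hr⟩ := Table.check_find hT (k := key (group i g l)) (l := group i g l)
          (by omega)
        have hev := even_of_entryCheck hr
        have he' : Even (codeFree (groupsBelow i g l)) := (Nat.even_add.1 he).1 hev
        have := (ih _ _ _ (by omega) hr).add hev he' (free_strips _) (free_strips _)
          (ihi hc he' (by omega))
        exact this.mono (by omega)

/-- The table is sound: the responder guarantees `t` good edges in each position with a checked
entry `t`. -/
theorem win_of_entryCheck {σ : Bool} {T : Table} (hT : Table.check σ T T = true) {l : List ℕ}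
    {t h : ℕ} (hc : entryCheck σ T t h l = true) : Win σ t (codeFree l) false (strips l) := by
  obtain ⟨n, hn⟩ : ∃ n, codeFree l = n := ⟨_, rfl⟩
  induction n using Nat.strong_induction_on generalizing l t h with
  | _ n ih =>
    have he := even_of_entryCheck hc
    simp only [entryCheck, Bool.and_eq_true, List.all_eq_true, List.mem_range, Nat.blt_eq] at hc
    obtain ⟨⟨h0, -⟩, hc⟩ := hc
    obtain ⟨m, hm⟩ : ∃ m, codeFree l = m + 2 := ⟨codeFree l - 2, by grind⟩
    rw [hm]
    intro s hs
    obtain ⟨v, hv, rfl⟩ := play_strips.1 hs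
    have hr := hc v hv
    have hp := codeFree_playAt σ false hv
    generalize h / 65536 ^ v % 65536 = r at hr
    change replyCheck σ T t r (playAt σ (code false) l v) = true at hr
    simp only [replyCheck, Bool.and_eq_true, Nat.blt_eq] at hr
    obtain ⟨hr, hg⟩ := hr
    change groupsCover T (r / 16) (sortCodes (playAt σ (code true) _ _).1) 4
      (t - _ - (playAt σ (code true) _ _).2) = true at hg
    have hp' := codeFree_playAt σ true hr
    refine Win.mono (c := t - (playAt σ (code false) l v).2 + (playAt σ (code false) l v).2)
      (by omega) ?_
    rw [← add_zero (outcome _ _ _)]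
    refine Win.of_playAt false hv ?_
    rw [add_zero]
    refine ⟨_, play_strips.2 ⟨_, hr, rfl⟩, ?_⟩
    generalize playAt σ (code false) l v = p at *
    refine Win.mono (c := t - p.2 - (playAt σ (code true) p.1 (r % 16)).2 +
      (playAt σ (code true) p.1 (r % 16)).2) (by omega) ?_
    rw [← add_zero (outcome _ _ _)]
    refine Win.of_playAt true hr ?_
    rw [add_zero]
    generalize playAt σ (code true) p.1 (r % 16) = p' at *
    have hperm := sortCodes_perm p'.1
    have hfree := codeFree_perm hperm
    have hm' : codeFree p'.1 = m := by omega
    have := win_groupsBelow hT (n := n) (fun l t h hl hc => ih _ hl hc rfl) hg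
    rw [groupsBelow_four, strips_perm hperm, hfree, hm'] at this
    exact this (by grind) (by omega)

theorem win_of_find {σ : Bool} {T : Table} (hT : Table.check σ T T = true) {l : List ℕ}
    (h : T.find (key l) l ≠ 0) : Win σ (T.find (key l) l) (codeFree l) false (strips l) := by
  obtain ⟨r, hr⟩ := Table.check_find hT h
  exact win_of_entryCheck hT hr

section Game

variable {V : Type*} [Fintype V] [DecidableEq V] {G : SimpleGraph V} {k : ℕ} {S0 S1 : Finset V}
  {x : ℤ}

lemma gameVal_true_le_iff (h : (S0 ∪ S1)ᶜ.Nonempty) :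
    gameVal G (k + 1) true S0 S1 ≤ x ↔ ∃ v ∉ S0 ∪ S1, gameVal G k false (insert v S0) S1 ≤ x := by
  rw [Finset.compl_eq_univ_sdiff] at h
  obtain rfl : ‹DecidableEq V› = Classical.decEq V := Subsingleton.elim _ _
  simp only [gameVal, dif_pos h, if_true, Finset.inf'_le_iff, Finset.mem_sdiff, Finset.mem_univ,
    true_and]

lemma le_gameVal_true_iff (h : (S0 ∪ S1)ᶜ.Nonempty) :
    x ≤ gameVal G (k + 1) true S0 S1 ↔ ∀ v ∉ S0 ∪ S1, x ≤ gameVal G k false (insert v S0) S1 := by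
  rw [Finset.compl_eq_univ_sdiff] at h
  obtain rfl : ‹DecidableEq V› = Classical.decEq V := Subsingleton.elim _ _
  simp only [gameVal, dif_pos h, if_true, Finset.le_inf'_iff, Finset.mem_sdiff, Finset.mem_univ,
    true_and]

lemma gameVal_false_le_iff (h : (S0 ∪ S1)ᶜ.Nonempty) :
    gameVal G (k + 1) false S0 S1 ≤ x ↔ ∀ v ∉ S0 ∪ S1, gameVal G k true S0 (insert v S1) ≤ x := by
  rw [Finset.compl_eq_univ_sdiff] at h
  obtain rfl : ‹DecidableEq V› = Classical.decEq V := Subsingleton.elim _ _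
  simp only [gameVal, dif_pos h, if_false, Bool.false_eq_true, Finset.sup'_le_iff,
    Finset.mem_sdiff, Finset.mem_univ, true_and]

lemma le_gameVal_false_iff (h : (S0 ∪ S1)ᶜ.Nonempty) :
    x ≤ gameVal G (k + 1) false S0 S1 ↔ ∃ v ∉ S0 ∪ S1, x ≤ gameVal G k true S0 (insert v S1) := by
  rw [Finset.compl_eq_univ_sdiff] at h
  obtain rfl : ‹DecidableEq V› = Classical.decEq V := Subsingleton.elim _ _
  simp only [gameVal, dif_pos h, if_false, Bool.false_eq_true, Finset.le_sup'_iff,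
    Finset.mem_sdiff, Finset.mem_univ, true_and]

lemma nonempty_compl_of_notMem {s : Finset V} {v : V} (h : v ∉ s) : sᶜ.Nonempty :=
  ⟨v, Finset.mem_compl.2 h⟩

lemma card_compl_insert {s : Finset V} {v : V} (h : v ∉ s) :
    (insert v s)ᶜ.card + 1 = sᶜ.card := by
  rw [Finset.compl_insert, Finset.card_erase_add_one (Finset.mem_compl.2 h)]

/-- If an even number of vertices is free, giving one of them to Impish does not decrease the value
of the game in which Admirable is to move. -/
lemma gameVal_le_insert {m : ℕ} (hm : (S0 ∪ S1)ᶜ.card = 2 * m) {e : V} (he : e ∉ S0 ∪ S1) :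
    gameVal G (2 * m) true S0 S1 ≤ gameVal G (2 * m - 1) true S0 (insert e S1) := by
  induction m generalizing S0 S1 e with
  | zero => exact absurd (Finset.mem_compl.2 he) (by simp [Finset.card_eq_zero.1 hm])
  | succ m ih =>
    have hc := card_compl_insert he
    rw [show 2 * (m + 1) - 1 = 2 * m + 1 by omega, le_gameVal_true_iff (by
      rw [Finset.union_insert, ← Finset.card_pos]; omega)]
    intro v hv
    rw [Finset.union_insert, Finset.mem_insert, not_or] at hv
    have hc' := card_compl_insert hv.2
    rw [show 2 * (m + 1) = 2 * m + 1 + 1 by ring,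
      gameVal_true_le_iff (nonempty_compl_of_notMem he)]
    refine ⟨v, hv.2, ?_⟩
    have he' : e ∉ insert v S0 ∪ S1 := by
      rw [Finset.insert_union, Finset.mem_insert, not_or]
      exact ⟨fun h => hv.1 h.symm, he⟩
    rw [gameVal_false_le_iff (nonempty_compl_of_notMem he')]
    intro u hu
    rw [← Finset.insert_union] at hc'
    have hcu := card_compl_insert hu
    have hce := card_compl_insert he'
    rw [← Finset.union_insert] at hcu hce
    by_cases hue : u = e
    · subst hue
      obtain rfl | hm0 := Nat.eq_zero_or_pos m
      · rfl
      obtain ⟨w, hw⟩ : (insert v S0 ∪ insert u S1)ᶜ.Nonempty := by rw [← Finset.card_pos]; omega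
      rw [Finset.mem_compl] at hw
      refine (ih (by omega) hw).trans ?_
      obtain ⟨j, hj⟩ : ∃ j, 2 * m = j + 1 := ⟨2 * m - 1, by omega⟩
      rw [hj, le_gameVal_false_iff (nonempty_compl_of_notMem hw)]
      exact ⟨w, hw, le_rfl⟩
    · have hu' : u ∉ insert v S0 ∪ insert e S1 := by
        rw [Finset.union_insert, Finset.mem_insert, not_or]
        exact ⟨hue, hu⟩
      have he'' : e ∉ insert v S0 ∪ insert u S1 := by
        rw [Finset.union_insert, Finset.mem_insert, not_or]
        exact ⟨fun h => hue h.symm, he'⟩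
      have hcu' := card_compl_insert hu'
      obtain ⟨j, hj⟩ : ∃ j, 2 * m = j + 1 := ⟨2 * m - 1, by omega⟩
      refine (ih (by omega) he'').trans ?_
      rw [hj, le_gameVal_false_iff (nonempty_compl_of_notMem hu')]
      exact ⟨u, hu', by rw [Finset.insert_comm]; rfl⟩

/-- If an even number of vertices is free, then it is not better for Impish to let Admirable move
first. -/
lemma gameVal_true_le_false (hk : Even k) (hc : (S0 ∪ S1)ᶜ.card = k) :
    gameVal G k true S0 S1 ≤ gameVal G k false S0 S1 := by
  obtain rfl | h0 := Nat.eq_zero_or_pos k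
  · rfl
  obtain ⟨m, rfl⟩ := hk.two_dvd
  obtain ⟨e, he⟩ : (S0 ∪ S1)ᶜ.Nonempty := by rw [← Finset.card_pos]; omega
  rw [Finset.mem_compl] at he
  refine (gameVal_le_insert hc he).trans ?_
  obtain ⟨j, hj⟩ : ∃ j, 2 * m = j + 1 := ⟨2 * m - 1, by omega⟩
  rw [hj, le_gameVal_false_iff (nonempty_compl_of_notMem he)]
  exact ⟨e, he, le_rfl⟩

end Game

lemma fill_iff_set {b : Bool} {u v : Strip} :
    Fill b u v ↔ ∃ i, u[i]? = some none ∧ v = u.set i (some b) := by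
  constructor
  · rintro ⟨l, r, rfl, rfl⟩
    exact ⟨l.length, by simp, by simp⟩
  · rintro ⟨i, hi, rfl⟩
    obtain ⟨h, hi⟩ := List.getElem?_eq_some_iff.1 hi
    refine ⟨u.take i, u.drop (i + 1), ?_, by
      rw [List.set_eq_take_append_cons_drop, if_pos h]⟩
    rw [← hi, ← List.drop_eq_getElem_cons h, List.take_append_drop]

lemma fill_ofFn {b : Bool} {n : ℕ} {f : Fin n → Option Bool} {v : Strip} :
    Fill b (List.ofFn f) v ↔
      ∃ i, f i = none ∧ v = List.ofFn (Function.update f i (some b)) := by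
  have key : ∀ i : Fin n, (List.ofFn f).set i (some b) =
      List.ofFn (Function.update f i (some b)) := by
    intro i
    refine List.ext_getElem (by simp) fun j hj hj' => ?_
    simp [List.getElem_set, Function.update_apply, Fin.ext_iff, eq_comm]
  rw [fill_iff_set]
  constructor
  · rintro ⟨i, hi, rfl⟩
    obtain ⟨h, hi⟩ := List.getElem?_eq_some_iff.1 hi
    rw [List.length_ofFn] at h
    exact ⟨⟨i, h⟩, by simpa using hi, key ⟨i, h⟩⟩
  · rintro ⟨i, hi, rfl⟩
    exact ⟨i, by simp [hi], (key i).symm⟩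

/-- The label of a vertex when the responder owns `T` and the opponent owns `F`. -/
def label {n : ℕ} (T F : Finset (Fin n)) (i : Fin n) : Option Bool :=
  if i ∈ T then some true else if i ∈ F then some false else none

/-- The path as a strip when the responder owns `T` and the opponent owns `F`. -/
def cells {n : ℕ} (T F : Finset (Fin n)) : Strip := List.ofFn (label T F)

lemma label_eq_none {n : ℕ} {T F : Finset (Fin n)} {i : Fin n} :
    label T F i = none ↔ i ∉ T ∪ F := by
  unfold label
  split_ifs <;> simp_all

lemma update_label_true {n : ℕ} (T F : Finset (Fin n)) (i : Fin n) :
    Function.update (label T F) i (some true) = label (insert i T) F := by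
  ext1 j
  by_cases h : j = i <;> simp [label, h]

lemma update_label_false {n : ℕ} {T F : Finset (Fin n)} {i : Fin n} (hi : i ∉ T ∪ F) :
    Function.update (label T F) i (some false) = label T (insert i F) := by
  rw [Finset.mem_union, not_or] at hi
  ext1 j
  by_cases h : j = i
  · simp [label, h, hi.1]
  · simp [label, h]

lemma play_cells_true {n : ℕ} {T F : Finset (Fin n)} {t : Multiset Strip} :
    Play true {cells T F} t ↔ ∃ i ∉ T ∪ F, t = {cells (insert i T) F} := by
  simp only [play_singleton, cells, fill_ofFn, label_eq_none, update_label_true]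
  constructor
  · rintro ⟨_, ⟨i, hi, rfl⟩, rfl⟩
    exact ⟨i, hi, rfl⟩
  · rintro ⟨i, hi, rfl⟩
    exact ⟨_, ⟨i, hi, rfl⟩, rfl⟩

lemma play_cells_false {n : ℕ} {T F : Finset (Fin n)} {t : Multiset Strip} :
    Play false {cells T F} t ↔ ∃ i ∉ T ∪ F, t = {cells T (insert i F)} := by
  simp only [play_singleton, cells, fill_ofFn, label_eq_none]
  constructor
  · rintro ⟨_, ⟨i, hi, rfl⟩, rfl⟩
    exact ⟨i, hi, by rw [update_label_false hi]⟩
  · rintro ⟨i, hi, rfl⟩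
    exact ⟨_, ⟨i, hi, rfl⟩, by rw [update_label_false hi]⟩

lemma good_ofFn (σ : Bool) {m : ℕ} (f : Fin (m + 1) → Option Bool) :
    good σ (List.ofFn f) = ∑ i : Fin m, goodEdge σ (f i.castSucc) (f i.succ) := by
  induction m with
  | zero => simp [good]
  | succ m ih =>
    have := ih fun i => f i.succ
    rw [List.ofFn_succ, List.ofFn_succ] at *
    rw [good, this, Fin.sum_univ_succ]
    simp

lemma edgeSet_pathGraph (m : ℕ) :
    (pathGraph (m + 1)).edgeSet = Set.range fun i : Fin m => s(i.castSucc, i.succ) := by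
  ext e
  induction e with
  | _ a b =>
    simp only [mem_edgeSet, pathGraph_adj, Set.mem_range, Sym2.eq_iff]
    constructor
    · rintro (h | h)
      · exact ⟨⟨a, by omega⟩, .inl ⟨rfl, Fin.ext h⟩⟩
      · exact ⟨⟨b, by omega⟩, .inr ⟨rfl, Fin.ext h⟩⟩
    · rintro ⟨i, ⟨rfl, rfl⟩ | ⟨rfl, rfl⟩⟩
      · exact .inl rfl
      · exact .inr rfl

lemma ncard_edges (m : ℕ) (P : Sym2 (Fin (m + 1)) → Prop) [DecidablePred P] :
    {e ∈ (pathGraph (m + 1)).edgeSet | P e}.ncard =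
      ∑ i : Fin m, if P s(i.castSucc, i.succ) then 1 else 0 := by
  have hinj : Function.Injective fun i : Fin m => s(i.castSucc, i.succ) := by
    intro i j h
    rcases Sym2.eq_iff.1 h with ⟨h, -⟩ | ⟨h, h'⟩
    · exact Fin.castSucc_injective _ h
    · rw [Fin.ext_iff] at h h'
      simp at h h'
      omega
  have himage : {e ∈ (pathGraph (m + 1)).edgeSet | P e} =
      (fun i : Fin m => s(i.castSucc, i.succ)) ''
        ({i | P s(i.castSucc, i.succ)} : Finset (Fin m)) := by
    ext e
    simp only [edgeSet_pathGraph, Set.mem_ofPred_eq, Set.mem_range, Set.mem_image,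
      Finset.coe_filter, Finset.mem_univ, true_and]
    constructor
    · rintro ⟨⟨i, rfl⟩, h⟩
      exact ⟨i, h, rfl⟩
    · rintro ⟨i, h, rfl⟩
      exact ⟨⟨i, rfl⟩, h⟩
  rw [himage, Set.ncard_image_of_injective _ hinj, Set.ncard_coe_finset, Finset.card_filter]

lemma goodEdge_label {m : ℕ} {T F : Finset (Fin m)} (hd : Disjoint T F) (hu : T ∪ F = Finset.univ)
    (i j : Fin m) :
    (goodEdge true (label T F i) (label T F j) =
      if ∃ u ∈ (T : Set (Fin m)), ∃ v ∈ (F : Set (Fin m)), s(i, j) = s(u, v) then 1 else 0) ∧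
    goodEdge false (label T F i) (label T F j) =
      if (∃ u ∈ (T : Set (Fin m)), ∃ v ∈ (T : Set (Fin m)), s(i, j) = s(u, v)) ∨
        ∃ u ∈ (F : Set (Fin m)), ∃ v ∈ (F : Set (Fin m)), s(i, j) = s(u, v) then 1 else 0 := by
  classical
  have key : ∀ A B : Finset (Fin m),
      (∃ u ∈ (A : Set (Fin m)), ∃ v ∈ (B : Set (Fin m)), s(i, j) = s(u, v)) ↔
        i ∈ A ∧ j ∈ B ∨ j ∈ A ∧ i ∈ B := by
    intro A B
    simp only [Sym2.eq_iff, Finset.mem_coe]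
    constructor
    · rintro ⟨u, hu, v, hv, ⟨rfl, rfl⟩ | ⟨rfl, rfl⟩⟩
      · exact .inl ⟨hu, hv⟩
      · exact .inr ⟨hu, hv⟩
    · rintro (⟨h, h'⟩ | ⟨h, h'⟩)
      · exact ⟨i, h, j, h', .inl ⟨rfl, rfl⟩⟩
      · exact ⟨j, h, i, h', .inr ⟨rfl, rfl⟩⟩
  have hF : ∀ x, x ∈ F ↔ x ∉ T := fun x => by
    have hx : x ∈ T ∪ F := hu ▸ Finset.mem_univ x
    exact ⟨fun h h' => Finset.disjoint_left.1 hd h' h, (Finset.mem_union.1 hx).resolve_left⟩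
  simp only [key, hF, label]
  by_cases hi : i ∈ T <;> by_cases hj : j ∈ T <;> simp [hi, hj, goodEdge]

lemma bscore_pathGraph {m : ℕ} {T F : Finset (Fin (m + 1))} (hd : Disjoint T F)
    (hu : T ∪ F = Finset.univ) :
    bscore (pathGraph (m + 1)) T F = (good true (cells T F) : ℤ) - good false (cells T F) := by
  classical
  rw [bscore, ncard_edges, ncard_edges, cells, good_ofFn, good_ofFn]
  simp only [goodEdge_label hd hu]

lemma good_cells_add {m : ℕ} {T F : Finset (Fin (m + 1))} (hu : T ∪ F = Finset.univ) :
    good true (cells T F) + good false (cells T F) = m := by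
  have key : ∀ i, ∃ x, label T F i = some x := fun i => by
    rw [← Option.isSome_iff_exists, Option.isSome_iff_ne_none, Ne, label_eq_none, not_not, hu]
    exact Finset.mem_univ i
  rw [cells, good_ofFn, good_ofFn, ← Finset.sum_add_distrib]
  rw [Finset.sum_congr rfl (g := fun _ => 1)]
  · simp
  · intro i _
    obtain ⟨x, hx⟩ := key i.castSucc
    obtain ⟨y, hy⟩ := key i.succ
    rw [hx, hy]
    cases x <;> cases y <;> rfl

lemma bscore_comm {V : Type*} (G : SimpleGraph V) (A B : Set V) : bscore G A B = bscore G B A := by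
  unfold bscore
  congr! 6 with e e
  · constructor
    · rintro ⟨u, hu, v, hv, rfl⟩
      exact ⟨v, hv, u, hu, Sym2.eq_swap⟩
    · rintro ⟨u, hu, v, hv, rfl⟩
      exact ⟨v, hv, u, hu, Sym2.eq_swap⟩
  · exact or_comm

lemma union_eq_univ {n : ℕ} {S0 S1 : Finset (Fin n)} (hk : (S0 ∪ S1)ᶜ.card = 0) :
    S0 ∪ S1 = Finset.univ := by
  rwa [Finset.card_eq_zero, Finset.compl_eq_empty_iff] at hk

lemma le_gameVal_of_win {m c k : ℕ} {t : Bool} {S0 S1 : Finset (Fin (m + 1))}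
    (hd : Disjoint S0 S1) (hk : (S0 ∪ S1)ᶜ.card = k) (hw : Win true c k (!t) {cells S1 S0}) :
    2 * (c : ℤ) - m ≤ gameVal (pathGraph (m + 1)) k t S0 S1 := by
  induction k generalizing t S0 S1 with
  | zero =>
    rw [Finset.union_comm] at hk
    have hu := union_eq_univ hk
    rw [gameVal, bscore_comm, bscore_pathGraph hd.symm hu]
    have h := good_cells_add hu
    rw [Win, total_singleton] at hw
    omega
  | succ k ih =>
    have hne : (S0 ∪ S1)ᶜ.Nonempty := by rw [← Finset.card_pos]; omega
    cases t with
    | true =>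
      rw [le_gameVal_true_iff hne]
      intro v hv
      have hc := card_compl_insert hv
      rw [← Finset.insert_union] at hc
      have hv' := hv
      rw [Finset.mem_union, not_or] at hv'
      exact ih (Finset.disjoint_insert_left.2 ⟨hv'.2, hd⟩) (by omega)
        (hw _ (play_cells_false.2 ⟨v, Finset.union_comm S0 S1 ▸ hv, rfl⟩))
    | false =>
      rw [le_gameVal_false_iff hne]
      obtain ⟨_, h, hw⟩ := hw
      obtain ⟨v, hv, rfl⟩ := play_cells_true.1 h
      rw [Finset.union_comm] at hv
      have hc := card_compl_insert hv
      rw [← Finset.union_insert] at hc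
      have hv' := hv
      rw [Finset.mem_union, not_or] at hv'
      exact ⟨v, hv, ih (Finset.disjoint_insert_right.2 ⟨hv'.1, hd⟩) (by omega) hw⟩

lemma gameVal_le_of_win {m c k : ℕ} {t : Bool} {S0 S1 : Finset (Fin (m + 1))}
    (hd : Disjoint S0 S1) (hk : (S0 ∪ S1)ᶜ.card = k) (hw : Win false c k t {cells S0 S1}) :
    gameVal (pathGraph (m + 1)) k t S0 S1 ≤ m - 2 * (c : ℤ) := by
  induction k generalizing t S0 S1 with
  | zero =>
    have hu := union_eq_univ hk
    rw [gameVal, bscore_pathGraph hd hu]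
    have h := good_cells_add hu
    rw [Win, total_singleton] at hw
    omega
  | succ k ih =>
    have hne : (S0 ∪ S1)ᶜ.Nonempty := by rw [← Finset.card_pos]; omega
    cases t with
    | false =>
      rw [gameVal_false_le_iff hne]
      intro v hv
      have hc := card_compl_insert hv
      rw [← Finset.union_insert] at hc
      have hv' := hv
      rw [Finset.mem_union, not_or] at hv'
      exact ih (Finset.disjoint_insert_right.2 ⟨hv'.1, hd⟩) (by omega)
        (hw _ (play_cells_false.2 ⟨v, hv, rfl⟩))
    | true =>
      rw [gameVal_true_le_iff hne]
      obtain ⟨_, h, hw⟩ := hw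
      obtain ⟨v, hv, rfl⟩ := play_cells_true.1 h
      have hc := card_compl_insert hv
      rw [← Finset.insert_union] at hc
      have hv' := hv
      rw [Finset.mem_union, not_or] at hv'
      exact ⟨v, hv, ih (Finset.disjoint_insert_left.2 ⟨hv'.2, hd⟩) (by omega) hw⟩

/-- Guarantees for edges whose ends belong to different players. -/
def differTable : Table :=
  (.node 22026 6 5530669218297631474485047066813920318564073702
  (.node 10277 5 4911993087528442118339802111461688244
  (.node 3341 2 0
  (.node 62 4 58032866623131256139874352
  (.node 38 2 14073757441261616
  (.node 22 2 0
  (.node 19 1 0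
  (.node 18 1 0
  .nil
  .nil)
  (.node 20 1 0
  .nil
  .nil))
  (.node 26 2 0
  (.node 23 1 0
  .nil
  .nil)
  (.node 37 2 563980748718130
  .nil
  .nil)))
  (.node 56 3 58032866623694206080647216
  (.node 41 3 14073963587043376
  (.node 40 2 563164704931842
  .nil
  .nil)
  (.node 44 2 13510807472046128
  .nil
  .nil))
  (.node 59 3 273221662515098199236149474
  (.node 58 4 273234390768509067416764642
  .nil
  .nil)
  .nil)))
  (.node 112 8 22029987319430113664180165257696317703129414020909105382
  (.node 91 5 5084891817129922216825363456090124266924081382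
  (.node 74 4 1173534040975585187922534773358199010
  (.node 73 4 1173532930947137964818960520685224162
  .nil
  .nil)
  (.node 77 5 1173534040975571943160289849900138722
  .nil
  .nil))
  (.node 109 7 21646863434213641449590578500908740407224729240363204838
  (.node 92 5 5084887053176785560537190967851128012662898916
  .nil
  .nil)
  .nil))
  (.node 2570 1 0
  (.node 127 8 93795335343981476163156690072077509176933319361233536828182626364
  (.node 113 7 22030988462948821322954434509700822885316649768828862690
  .nil
  .nil)
  (.node 144 9 109551338979852962004464848398002737294574003320263419554625503357065625662
  .nil
  .nil))
  (.node 3338 1 0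
  (.node 2827 1 0
  .nil
  .nil)
  .nil))))
  (.node 7441 2 50
  (.node 4369 2 0
  (.node 3598 2 0
  (.node 3595 1 0
  (.node 3594 1 0
  .nil
  .nil)
  (.node 3597 1 0
  .nil
  .nil))
  (.node 4366 1 0
  (.node 4363 1 0
  .nil
  .nil)
  .nil))
  (.node 7435 1 2
  (.node 7185 2 48
  (.node 7179 2 1030795296816
  .nil
  .nil)
  (.node 7434 2 68116952957059074
  .nil
  .nil))
  (.node 7438 2 67835477980348418
  (.node 7437 2 68116952957059072
  .nil
  .nil)
  .nil)))
  (.node 8970 2 13510803180224512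
  (.node 8205 3 68117983749210114
  (.node 8202 2 68116952953978882
  (.node 7453 3 273234390768509067416830180
  .nil
  .nil)
  (.node 8203 2 13510807472046130
  .nil
  .nil))
  (.node 8224 4 273221717855330428909519076
  (.node 8209 3 13511833969229874
  .nil
  .nil)
  .nil))
  (.node 8977 2 48
  (.node 8973 2 13510803180224512
  (.node 8971 2 67835473698029616
  .nil
  .nil)
  (.node 8974 3 13511829677408304
  .nil
  .nil))
  (.node 8995 4 270816502235228703104827618
  (.node 8989 3 273234390768509058826764514
  .nil
  .nil)
  .nil)))))
  (.node 16430 7 87545294141831566155976119156714221342055662003229492120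
  (.node 12810 3 58045613522007583114658018
  (.node 12043 3 58045613323289213084368944
  (.node 11793 3 17173981787021301055714
  (.node 11789 3 1124374836373726799367110882
  (.node 11787 2 73823932837383379288290
  .nil
  .nil)
  (.node 11790 3 1125527112241446641578737890
  .nil
  .nil))
  (.node 11811 4 4927564907378335217609819008001115028
  (.node 11805 4 1173534040975585187922537737065071508
  .nil
  .nil)
  .nil))
  (.node 12555 3 1125527112043006782997725410
  (.node 12046 3 1125527112043006774407725282
  (.node 12045 3 291355623794452379678605316
  .nil
  .nil)
  (.node 12049 3 291368296707633977360384048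
  .nil
  .nil))
  (.node 12591 6 20383204725252995804712404099712449148590883734
  (.node 12590 6 20383204725252995804712404099712449148590883734
  .nil
  .nil)
  .nil)))
  (.node 12849 7 20384139494602039702303607787660728015195931542
  (.node 12829 4 1173534040975585187922537737065071508
  (.node 12814 4 1125514365342851841107558626
  (.node 12811 3 1125527112043006774407725282
  .nil
  .nil)
  (.node 12828 4 1173534040973167336283308478715659156
  .nil
  .nil))
  (.node 12846 6 20384139494602039702303607787660728023785866134
  (.node 12835 5 1163149288799772615807309084735308692
  .nil
  .nil)
  .nil))
  (.node 16397 5 4828916337695170829155821381816025316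
  (.node 15141 6 5530663773945914239039447215995082680923456420
  (.node 12850 6 20384139494602039702303607788436484411379549078
  .nil
  .nil)
  (.node 16395 4 4828909681671182298826366875369406692
  .nil
  .nil))
  (.node 16416 6 20784616436895486295981560606518358292841956246
  (.node 16398 4 4829126612542529935410347255502340324
  .nil
  .nil)
  .nil))))
  (.node 17458 8 23945608282836906059570308283877866729058714080984302486
  (.node 16689 7 87549212486417827071815371281305018163941038379309925270
  (.node 16654 4 4844730044552524713923939633599742178
  (.node 16650 4 4829153149814644988137646592545128674
  (.node 16431 6 87545187449849182501621013858098309326097369566043177880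
  .nil
  .nil)
  (.node 16653 4 4829153153975767659255985286487867620
  .nil
  .nil))
  (.node 16686 6 87545194818416804419693229351699881102691257017304482710
  (.node 16669 5 20785591686159081467933358837095830827297932180
  .nil
  .nil)
  .nil))
  (.node 17418 4 4829153153976976585070814841058492642
  (.node 17162 5 4828916337695170829155821381816025136
  (.node 16704 8 103668369290666891671443212465906931552027498920049934305112883445
  .nil
  .nil)
  (.node 17165 6 4828916337695170829155821381816025136
  .nil
  .nil))
  (.node 17454 7 23945608282836906059570308283834345399552587430694880150
  (.node 17421 5 4829153153975711322899584177517232354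
  .nil
  .nil)
  .nil)))
  (.node 21261 6 5530669218297631474485047066813920318564073700
  (.node 18725 7 87928418027048011133791057197555050777498586860523487458
  (.node 18190 5 4829153153975711268325258566452773090
  (.node 18187 4 4828909685832361325712453737558180066
  .nil
  .nil)
  (.node 18222 7 87545194818416804419693229351699881101920004220749284246
  .nil
  .nil))
  (.node 21259 5 20785542359505302150671808663633050951076806884
  (.node 21006 6 21120053523713063640578022643740551438936768738
  .nil
  .nil)
  .nil))
  (.node 21774 7 20852444581341080756596663679725832093523443938
  (.node 21770 6 20852444581330696158717262427537291702211903714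
  (.node 21294 8 103668369290475329729191788295984314275195555553249309878262104984
  .nil
  .nil)
  (.node 21771 6 20852444581341080756596663679725832093523443938
  .nil
  .nil))
  (.node 21795 8 89752155768150078734238499974931765133061711472555721620
  (.node 21789 7 89752155768194680224645945814924652669946381413177885588
  .nil
  .nil)
  .nil))))))
  (.node 3607818 5 4829159730034142800833651282708595621
  (.node 2630413 6 4907037844949256004215249651300041652
  (.node 1315082 2 281479287537664
  (.node 25610 7 89077789682697438680863991576712158533896626239924994276
  (.node 22797 6 20785591700448505529145031672320443918535885028
  (.node 22030 6 20852444595100885071480066767817398610618941670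
  (.node 22029 7 5530669218297631553713209581078257912108024038
  .nil
  .nil)
  (.node 22048 8 21651885230420528058370600732266541857717222651123008408
  .nil
  .nil))
  (.node 23334 8 378472444648243689901482395764877348264301492952278250509243384051
  (.node 23315 7 87928418027048011133770288881630749593985239437130596593
  .nil
  .nil)
  (.node 23589 8 103668268857230687427516028234722092881507323572819602831720972514
  .nil
  .nil)))
  (.node 25869 7 23083579541880375102794796877366811448309166236498985186
  (.node 25614 7 90901504039773281764322115100406996349149430746726400228
  (.node 25611 6 89081665644494355565265258048143039019853437037424607460
  .nil
  .nil)
  (.node 25629 8 383408958320207425009449941932268604982378806849045677833108652950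
  .nil
  .nil))
  (.node 1248523 2 1030792151281
  (.node 30219 8 383408958320207354857371350048928528669371477214112754417726914608
  .nil
  .nil)
  .nil)))
  (.node 2433805 5 20795466231775686350811338896055795936
  (.node 2428429 4 4839403899293376650837951394
  (.node 1511690 2 281479287537664
  (.node 1510667 2 67553994410557682
  .nil
  .nil)
  (.node 1511693 3 67835473698095104
  .nil
  .nil))
  (.node 2433038 5 19533711315913161723320026916210344885
  (.node 2432013 5 4907044182912114948654967808854196450
  .nil
  .nil)
  .nil))
  (.node 2625034 4 1126792707324391259881210786
  (.node 2624778 4 1126788280038259575178265506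
  (.node 2493707 3 290159389334197508411228401
  .nil
  .nil)
  (.node 2624779 4 1126788280038259575178265506
  .nil
  .nil))
  (.node 2630410 5 20795466232065884994555433969941480372
  (.node 2625037 5 4839403899360930645248443298
  .nil
  .nil)
  .nil))))
  (.node 3218707 6 20428742688674777458971624798478106527958175350
  (.node 3024397 6 20718782021687641996710090294124905487767176086
  (.node 3022871 6 20428741665574219542639420365052222981083958902
  (.node 3020557 5 4917422200570803374133073810599248788
  (.node 3019533 5 4917428776513127761351282948907860884
  .nil
  .nil)
  (.node 3020558 5 19050827867027450301183435993599181716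
  .nil
  .nil))
  (.node 3024163 7 353341394710215669422065557902960973635539537830835916360
  (.node 3024142 6 81867284820272056809833242656013376356057547670
  .nil
  .nil)
  .nil))
  (.node 3089696 7 87549199332902987633643681481755849329686062560705580616
  (.node 3086093 5 4828911349623769697279072461037699988
  (.node 3024416 7 87549189102391526317323015354746307818974141749071515208
  .nil
  .nil)
  (.node 3089677 6 22657875701784204019774472654964421600192234390
  .nil
  .nil))
  (.node 3217166 6 19050827867027450301183435993599181716
  (.node 3217162 5 4829126771500557425867446586654851988
  .nil
  .nil)
  .nil)))
  (.node 3281933 5 4828911349626191976136879409679500180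
  (.node 3221002 6 4996616122255842238860300687652156707251291030
  (.node 3220247 7 20384141198251754728393461372150928064950701686
  (.node 3220243 6 20384141198246562431534926544522397568621481590
  .nil
  .nil)
  (.node 3220747 6 81755781095598247096187365653198852632037688214
  .nil
  .nil))
  (.node 3221021 7 87549199342670716752859028610071703643626398882388774472
  (.node 3221006 6 81778081840796777719330110297291115622718374806
  .nil
  .nil)
  .nil))
  (.node 3286282 6 81759699444894258442506852888958463132958917526
  (.node 3283987 6 20384139494602039702303658257952513680414737329
  (.node 3282701 6 4829153153975767659255985647466513300
  .nil
  .nil)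
  (.node 3285015 7 20428741665574219542639420365034208582574476918
  .nil
  .nil))
  (.node 3286556 7 87357624236735413377250207375937823862293046253382009842
  (.node 3286301 7 87549189102391526317323238368785849630273770866540088904
  .nil
  .nil)
  .nil)))))
  (.node 6032651 7 97510607669862606010504263896478033137852836689591009521
  (.node 4204046 7 351808869940744281709400763490728096003860679865026479000
  (.node 3869963 5 5265063018092512860738349960368620450
  (.node 3617291 7 365597347216575560168691596259388006332882574298617217269
  (.node 3611917 6 20785685279875165518518931117993733195239457703
  (.node 3607819 4 4829137938877862715187778384014082981
  .nil
  .nil)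
  (.node 3613453 6 20785591702224262101985153791324287508306920439
  .nil
  .nil))
  (.node 3869962 5 5265063018092512860738349960368620467
  (.node 3682571 7 354315143796884319742375922004380638592164221824208864146
  .nil
  .nil)
  .nil))
  (.node 4199182 6 81867283460461435063443548948737148871335347094
  (.node 3870221 6 5265063031708648794262985246494557090
  (.node 3870218 5 5265063018092517287943416851778896802
  .nil
  .nil)
  (.node 3874061 6 22501770428819460141274213646214150635593728932
  .nil
  .nil))
  (.node 4203283 7 353341388865591869760818599182133711163246023998123282024
  (.node 4200206 6 81867283460440665876009409638224997210855441302
  .nil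
  .nil)
  .nil)))
  (.node 4787467 6 85034132195595520001991866179965624748496519409
  (.node 4269581 7 97506423142244626463685288122350899201888821943125803926
  (.node 4265741 6 22547328452949935907816221519167202508200543124
  (.node 4264717 6 22657881089727051655684171176706760944907322260
  .nil
  .nil)
  (.node 4269326 7 97506423385724026089758101694842438322804548043610981270
  .nil
  .nil))
  (.node 4658954 6 20740968091697609636977866623654666826240295828
  (.node 4465931 7 97506423385612522364097755578080988699667303132847014806
  .nil
  .nil)
  .nil))
  (.node 4857101 7 97506399758285331405249567410902194860323588756411450341
  (.node 4791566 7 353070134161703150733532011186429259690332114189632668580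
  (.node 4787722 6 81804214165446838109571458088108297582316487586
  .nil
  .nil)
  (.node 4853002 6 22657875645037835124472504667029117664732971941
  .nil
  .nil))
  (.node 5967371 7 351537638620837256430567306104080917519575998863547564273
  (.node 5640971 7 21476271438117314204238505817447186062266754306738749680
  .nil
  .nil)
  .nil))))
  (.node 622860043 6 82606927392859623527396722409440467285263647636
  (.node 488051469 5 19046508901703822593107090735299232662
  (.node 387386893 5 4839347249409867084780929248
  (.node 387190285 4 4839347249342313090370502880
  (.node 320015885 4 4548052758319225471047368928
  .nil
  .nil)
  (.node 387386634 4 4549205052634802088440890274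
  .nil
  .nil))
  (.node 471274254 5 19050827867026241338470051742028661652
  (.node 470682890 4 4839403899293363452403385250
  .nil
  .nil)
  .nil))
  (.node 622267659 5 4902692193442863165392539849397109666
  (.node 588715789 6 19036143164287011931596658689958806420
  (.node 488377869 5 21216023341665531930666394602118906803
  .nil
  .nil)
  (.node 589043475 6 81447288245423971362249272965095970233008918131
  .nil
  .nil))
  (.node 622663438 6 82540025166469974225529367169126493372342862740
  (.node 622267914 5 19056912446308710174196363812753506528
  .nil
  .nil)
  .nil)))
  (.node 823987723 6 332977595873716502516413206660688206453330546294
  (.node 640028173 6 91099793729705609183485100977370804112175730259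
  (.node 639045133 5 20785088068747351340425235821571018325
  (.node 639044874 5 19538903864073524545193327517388374963
  .nil
  .nil)
  (.node 639440653 6 89248842709628829014329119871803046584719311764
  .nil
  .nil))
  (.node 774049035 6 20696387415879927751776495324171559536735749108
  (.node 772672779 5 19788141243531307965119091964195898354
  .nil
  .nil)
  .nil))
  (.node 941034763 6 83922703289515064804658911910669390948336927731
  (.node 840764683 6 20696387358680684100123546187733103685627151345
  (.node 839715594 5 4823961187649641154876672661318405811
  .nil
  .nil)
  (.node 924257803 6 81800380267806972608359037415572410176149783539
  .nil
  .nil))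
  (.node 124940848395 5 76290302720921859136842994109312733091
  (.node 99019983626 4 4836986066168432258064846516
  .nil
  .nil)
  .nil)))))))

/-- Guarantees for edges whose ends belong to the same player. -/
def agreeTable : Table :=
  (.node 1511690 2 1030792151281
  (.node 8992 3 270813255608274002462835619
  (.node 2827 1 0
  (.node 58 3 58029398640593483418566704
  (.node 41 2 1030807945457
  (.node 37 1 67835477977268224
  (.node 26 1 0
  (.node 22 1 0
  .nil
  .nil)
  .nil)
  (.node 38 1 1030795297009
  .nil
  .nil))
  (.node 55 2 58042348254933227523801136
  (.node 54 1 62882774115487757511098420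
  (.node 44 1 1030807945216
  .nil
  .nil)
  .nil)
  (.node 56 2 62882755646224586153001008
  .nil
  .nil)))
  (.node 90 3 5084887733824596152150675136657675311116648676
  (.node 72 2 1173532693262663630098207960725586146
  (.node 62 3 58047052367766825368420400
  (.node 59 2 959293745470429593648
  .nil
  .nil)
  .nil)
  (.node 80 3 1173532693262663611651182412039323874
  .nil
  .nil))
  (.node 131 6 94622374946918495304283004780106141126848619787794731335467466993
  (.node 126 5 103261776050476088118099486557224202802944913624387283098197754107
  (.node 108 4 22031010385785591719360713037813691077544038502334071014
  .nil
  .nil)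
  .nil)
  (.node 144 6 84836158674161617637143435995632023058021587649148846646526802284271960112
  .nil
  .nil))))
  (.node 7182 2 67836504490180610
  (.node 4366 1 0
  (.node 3598 2 0
  (.node 3595 1 0
  (.node 3594 1 0
  .nil
  .nil)
  .nil)
  (.node 4363 1 0
  .nil
  .nil))
  (.node 5140 1 563980745572593
  (.node 5139 1 562954264182784
  (.node 4369 2 0
  .nil
  .nil)
  .nil)
  (.node 7178 1 2
  .nil
  .nil)))
  (.node 7947 2 67836500195213312
  (.node 7452 2 2431760547878522562216176
  (.node 7438 2 1030807945457
  (.node 7185 1 67835477977268224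
  .nil
  .nil)
  .nil)
  (.node 7453 2 1219876415900832192786531235
  .nil
  .nil))
  (.node 8221 2 3700583143373061460459746
  (.node 8206 2 1039397879808
  (.node 7950 3 67836500195213360
  .nil
  .nil)
  .nil)
  (.node 8974 3 67836500195213553
  .nil
  .nil)))))
  (.node 13582 3 911603892120720829521723440
  (.node 11790 2 912752884419300380473753604
  (.node 11283 2 1226063106349363073516274
  (.node 9748 2 1222242598209628416010028018
  (.node 9747 2 1227538845878498242986739
  (.node 9492 2 1222237875794448163419717876
  .nil
  .nil)
  .nil)
  (.node 9766 3 4912236162832612294695386062604469173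
  .nil
  .nil))
  (.node 11301 3 4844487999227765147801486740948058352
  (.node 11287 3 912756112648757450504274930
  (.node 11284 2 912756112648757450521052146
  .nil
  .nil)
  .nil)
  (.node 11787 2 1221088901893075297903837188
  .nil
  .nil)))
  (.node 12049 2 1222237894290185045104787456
  (.node 12043 2 1222294285986818375204077620
  (.node 12042 2 18612827837960477999152
  (.node 11793 2 1221088901965133991453392896
  .nil
  .nil)
  .nil)
  (.node 12046 2 73824131290431793266740
  .nil
  .nil))
  (.node 12817 3 58042330001297149862739968
  (.node 12811 2 1227538845892448296763392
  (.node 12061 3 4927569585264866797875115445056569570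
  .nil
  .nil)
  .nil)
  (.node 12832 4 1163154359444542397913048152402952418
  .nil
  .nil))))
  (.node 1248779 2 67836500179550208
  (.node 16651 3 4828909685929075391398717661846307042
  (.node 15127 4 1173532614904927669080370045657481457
  (.node 14356 3 1173782583146279246310252545533149425
  (.node 14099 3 1251417147017158481226250922577232820
  .nil
  .nil)
  .nil)
  (.node 16398 3 4829153150671773394045697343855198436
  .nil
  .nil))
  (.node 25614 5 97318829178098079075481853854594056960845270028695044324
  (.node 17422 4 4917178729123459184983043848691384546
  (.node 16654 3 4844486576196347397697891829662482658
  .nil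
  .nil)
  .nil)
  (.node 26638 6 89560690343859297280718484289627434916986893459621347558
  .nil
  .nil)))
  (.node 1315086 2 1030792151281
  (.node 1315082 1 241
  (.node 1314314 2 1030792151281
  (.node 1249550 2 67555029497675778
  .nil
  .nil)
  .nil)
  (.node 1315083 2 67555025202708721
  .nil
  .nil))
  (.node 1510923 2 282510063894528
  (.node 1510154 2 1030792151281
  .nil
  .nil)
  (.node 1510925 3 1030792151281
  .nil
  .nil))))))
  (.node 4796174 6 1682551416878020277323049619998304849715226718621079285853328049062
  (.node 3020561 4 21211823457272149790892124553083224294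
  (.node 1906449 3 1219879957675707195575173120
  (.node 1513239 4 909130810879900950469870577
  (.node 1512467 2 4854316043514706874532593
  (.node 1511694 3 67836500179419377
  (.node 1511691 2 563980745572353
  .nil
  .nil)
  .nil)
  (.node 1512468 2 4854297597333583069119475
  .nil
  .nil))
  (.node 1906443 2 1282731504143798999646208
  (.node 1905425 2 2431779192793005784498176
  (.node 1840913 3 1222297809337441605601460224
  .nil
  .nil)
  .nil)
  (.node 1906446 3 912812799493577430654910704
  .nil
  .nil)))
  (.node 2497553 3 20795466072986963169042324193669349378
  (.node 2103057 3 1219879957675703072193642496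
  (.node 2103054 4 910394947854348172305498352
  (.node 2102286 3 910394947854362126654243056
  .nil
  .nil)
  .nil)
  (.node 2429198 3 1221088902807307121768530164
  .nil
  .nil))
  (.node 3019790 3 4824915556885355551094565820299608310
  (.node 2888723 3 20795445632428101646953230838411821985
  (.node 2887179 3 4839399453627773411864478450
  .nil
  .nil)
  .nil)
  (.node 3019793 3 21205663863777478309965914135066968070
  .nil
  .nil))))
  (.node 3616526 5 391079062327623980193726457911268294469357158594018476256
  (.node 3085073 3 4829077095036694760875462784312279041
  (.node 3025931 4 91037185120955585301046672324809487560992751864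
  (.node 3024398 4 89274729692328886473824726346482381804590858472
  (.node 3024142 4 20789376322703968680953950916157631279751758056
  .nil
  .nil)
  .nil)
  (.node 3085070 3 14564716180998393401437498074665779426
  .nil
  .nil))
  (.node 3286301 5 351042742004462225200478337070346495263016559325149004694
  (.node 3089678 4 77942380206509834925665028718498927457998209252
  (.node 3085326 3 4823967274384492230165915296191348962
  .nil
  .nil)
  .nil)
  (.node 3608846 4 21206631095946441779348217120746111222
  .nil
  .nil)))
  (.node 4204046 5 390983287196434828577621772830883554717543544805613109476
  (.node 4199438 4 83584380950703856027306446395820974692022485218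
  (.node 3870990 5 4828909606701139609502050094412923121
  (.node 3617291 5 90518374369413886452761746146964714431343273947751383264
  .nil
  .nil)
  .nil)
  (.node 4200206 5 20722936254350042243279070194192220269655359728
  .nil
  .nil))
  (.node 4273934 6 1510669055215071754944147319453661854287782702559575360380064564152
  (.node 4269326 5 351538109215358808522157528800854355450335364799007294457
  (.node 4208654 6 1680083197709325598374771248105261539903089165255525030819843670246
  .nil
  .nil)
  .nil)
  (.node 4462350 6 89672571500351547422813246392259294581392277744
  .nil
  .nil)))))
  (.node 773656846 5 365157945420298324139659462736296876637434676209
  (.node 387191054 4 4838194955094290467375875057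
  (.node 7147019 6 1682620753864952223237957696368350404677557169176166779159841211302
  (.node 5971214 6 1682622159821170413421758083643648521688129419590532103726019511206
  (.node 5383694 6 1682622159819654482791622996473491413879599252345634422224016769958
  (.node 5379086 5 391574435653184190927713536218447629216084734796208800676
  .nil
  .nil)
  .nil)
  (.node 6558734 6 1682624250186194756088671695551491675679158758000182449091541074854
  .nil
  .nil))
  (.node 387190283 3 909181614128167959288546033
  (.node 387125518 4 4839403899293095175849640946
  (.node 336793870 3 4839343928928111546047923186
  .nil
  .nil)
  .nil)
  (.node 387191050 3 4838135003176036948345095153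
  .nil
  .nil)))
  (.node 622072078 4 21206631016720697116723108776960394225
  (.node 487656970 3 4839403843154864203008967666
  (.node 471274257 4 21196246487470804206400461572800906161
  (.node 387387662 5 4838194955094290467375875057
  .nil
  .nil)
  .nil)
  (.node 488378638 4 20796424496379593633367764591775646707
  .nil
  .nil))
  (.node 639963406 5 83632876348229687380208453444958410312121779188
  (.node 639045131 4 20780862672673073850673229822880187297
  (.node 622663438 5 89230127585085984799331830223722514573493273504
  .nil
  .nil)
  .nil)
  (.node 773264398 5 89274729756059138036253094810106022416345465842
  .nil
  .nil))))
  (.node 941365006 6 364852035721654902098851819425846858990734823655271039904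
  (.node 790959886 6 359297863263648228187334144257652508290879400745977054192
  (.node 790041358 5 89676866943165525390740820759150649352839824370
  (.node 789646858 4 84597977681343298353599166345666105332
  (.node 774248206 6 383242073923141151727220302820005806013614125231231337456
  .nil
  .nil)
  .nil)
  (.node 790368526 5 365157167272954657915911214252242098303091082227
  .nil
  .nil))
  (.node 940773646 5 359448491943885035211465070178927830323320590326
  (.node 924653326 6 383242077189018383874494706494566723610061126340968055712
  (.node 924061966 5 365174672000054709061341604727475575623171572728
  .nil
  .nil)
  .nil)
  (.node 941035018 5 363347315615692624434323503652494563181252903841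
  .nil
  .nil)))
  (.node 99121041678 5 84588903774288557480082421906355326962
  (.node 1226247691 6 360413935702507392115587490071317238756925856795179880105
  (.node 1075254286 6 383505382442672201418705941865120416082025380198914196466
  (.node 1074859531 5 365157401052584921463973703229853204436675068834
  .nil
  .nil)
  .nil)
  (.node 99070380810 4 4835777066561572237186633395
  .nil
  .nil))
  (.node 120646077963 5 83346634074375830969927465053032943606
  (.node 120646077962 5 21189313721096722388765018794843181046
  .nil
  .nil)
  (.node 124941045258 5 21189648365687017130000415707259473908
  .nil
  .nil)))))))

lemma check_differTable : Table.check true differTable differTable = true := by decide +kernel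

lemma check_agreeTable : Table.check false agreeTable agreeTable = true := by decide +kernel

lemma strips_free_segment (r : ℕ) : strips [9 * r] = {List.replicate r none} := by
  simp [strips, strip, segStrip, show 9 * r / 3 % 3 = 0 by omega, show 9 * r % 3 = 0 by omega, ends]

lemma win_replicate_of_find {σ : Bool} {T : Table} (hT : Table.check σ T T = true) {r t : ℕ}
    (ht : t ≠ 0) (h : T.find (key [9 * r]) [9 * r] = t) :
    Win σ t r false {List.replicate r none} := by
  have hw := win_of_find hT (h ▸ ht)
  rwa [h, strips_free_segment, show codeFree [9 * r] = r by simp [codeFree]] at hw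

lemma Win.add_replicate {σ : Bool} {c d k l : ℕ} (hk : Even k) (hl : Even l)
    (h : Win σ c k false {List.replicate k none}) (h' : Win σ d l false {List.replicate l none}) :
    Win σ (c + d) (k + l) false {List.replicate (k + l) none} := by
  rw [List.replicate_add, ← add_zero ({_} : Multiset Strip)]
  refine Win.of_cut ?_
  rw [add_zero]
  exact h.add hk hl (by simp [free_singleton]) (by simp [free_singleton]) h'

lemma win_zero_replicate (σ : Bool) {m : ℕ} (hm : Even m) :
    Win σ 0 m false {List.replicate m none} :=
  win_zero σ hm (by simp [free_singleton])

lemma win_differ {m : ℕ} (hm : Even m) :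
    Win true (9 * (m / 16) + m % 16 / 2) m false {List.replicate m none} := by
  induction m using Nat.strong_induction_on with
  | _ m ih =>
    by_cases h : 16 ≤ m
    · have := (win_replicate_of_find (t := 9) check_differTable (by decide)
        (by decide +kernel)).add_replicate (k := 16) (by decide) (by grind)
        (ih (m - 16) (by omega) (by grind))
      rw [show 16 + (m - 16) = m by omega] at this
      exact this.mono (by omega)
    by_cases h : 2 ≤ m
    · have := (win_replicate_of_find (t := 1) check_differTable (by decide)
        (by decide +kernel)).add_replicate (k := 2) (by decide) (by grind)
        (ih (m - 2) (by omega) (by grind))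
      rw [show 2 + (m - 2) = m by omega] at this
      exact this.mono (by omega)
    · exact (win_zero_replicate true hm).mono (by grind)

lemma win_agree {m : ℕ} (hm : Even m) :
    Win false (6 * (m / 16) + (m % 16 - 4) / 2) m false {List.replicate m none} := by
  induction m using Nat.strong_induction_on with
  | _ m ih =>
    by_cases h : 16 ≤ m
    · have := (win_replicate_of_find (t := 6) check_agreeTable (by decide)
        (by decide +kernel)).add_replicate (k := 16) (by decide) (by grind)
        (ih (m - 16) (by omega) (by grind))
      rw [show 16 + (m - 16) = m by omega] at this
      exact this.mono (by omega)
    obtain ⟨k, rfl⟩ := hm.two_dvd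
    have hk : k < 8 := by omega
    clear ih h
    interval_cases k
    · exact win_zero_replicate false hm
    · exact win_zero_replicate false hm
    · exact win_zero_replicate false hm
    all_goals
      exact win_replicate_of_find check_agreeTable (by decide) (by decide +kernel)

lemma cells_empty {n : ℕ} : cells (∅ : Finset (Fin n)) ∅ = List.replicate n none := by
  refine List.ext_getElem (by simp [cells]) fun i _ _ => ?_
  simp [cells, label]

lemma ofFn_update_none {m : ℕ} (u : Fin (m + 1)) (x : Option Bool) :
    List.ofFn (Function.update (fun _ => none) u x) =
      List.replicate u none ++ x :: List.replicate (m - u) none := by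
  refine List.ext_getElem (by simp; omega) fun i _ _ => ?_
  simp only [List.getElem_ofFn, Function.update_apply, List.getElem_append, List.getElem_cons,
    List.getElem_replicate, List.length_replicate, Fin.ext_iff]
  grind

lemma label_empty {n : ℕ} : label (∅ : Finset (Fin n)) ∅ = fun _ => none := by
  ext1 i
  simp [label]

lemma cells_singleton_left {m : ℕ} (u : Fin (m + 1)) :
    cells {u} ∅ = List.replicate u none ++ some true :: List.replicate (m - u) none := by
  rw [← ofFn_update_none, ← label_empty, update_label_true]
  rfl

lemma cells_singleton_right {m : ℕ} (u : Fin (m + 1)) :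
    cells ∅ {u} = List.replicate u none ++ some false :: List.replicate (m - u) none := by
  rw [← ofFn_update_none, ← label_empty, update_label_false (by simp)]
  rfl

lemma win_agree_append_some {i j : ℕ} (hi : Even i) (hj : Even j) {c d : ℕ}
    (hc : Win false c i false {List.replicate i none})
    (hd : Win false d j false {List.replicate j none}) :
    Win false (c + d) (i + j) false
      {List.replicate i none ++ some false :: List.replicate j none} := by
  rw [← add_zero ({_} : Multiset Strip)]
  refine Win.of_cut ?_
  rw [add_zero, add_comm ({_} : Multiset Strip), ← List.singleton_append]
  refine Win.of_cut ?_
  rw [add_assoc]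
  refine Win.of_drop (u := [some false]) (by simp) ?_
  rw [add_comm ({_} : Multiset Strip)]
  exact hc.add hi hj (by simp [free_singleton]) (by simp [free_singleton]) hd

/-- A known vertex in the middle of three vertices guarantees one good edge. -/
lemma win_agree_middle : Win false 1 2 false {[none, some false, none]} := by
  have h : agreeTable.find (key [11, 11]) [11, 11] = 1 := by decide +kernel
  have hw := win_of_find check_agreeTable (h.symm ▸ one_ne_zero)
  rw [h] at hw
  have hs : strips [11, 11] = {[none, some false]} + {[none, some false]} := rfl
  rw [hs] at hw
  rw [← add_zero ({_} : Multiset Strip)]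
  refine Win.of_cut_some (l := [none]) (r := [none]) ?_
  rw [add_zero, add_comm]
  exact Win.of_reverse (u := [some false, none]) hw

lemma win_agree_append_none {i j : ℕ} (hi : Even i) (hj : Even j) {c d : ℕ}
    (hc : Win false c i false {List.replicate i none})
    (hd : Win false d j false {List.replicate j none}) :
    Win false (c + d + 1) (i + j + 2) false
      {List.replicate (i + 1) none ++ some false :: List.replicate (j + 1) none} := by
  rw [List.replicate_succ', List.append_assoc, List.replicate_succ,
    ← add_zero ({_} : Multiset Strip)]
  refine Win.of_cut ?_
  rw [add_zero, add_comm ({_} : Multiset Strip)]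
  refine Win.of_cut (l := [none, some false, none]) ?_
  have hij := hc.add hi hj (by simp [free_singleton]) (by simp [free_singleton]) hd
  have := win_agree_middle.add (by decide) (hi.add hj) (by simp [free_singleton])
    (by rw [free_add, free_singleton, free_singleton, List.count_replicate_self,
      List.count_replicate_self]) hij
  convert this using 1 <;> abel

lemma win_agree_singleton {m : ℕ} (hm : Even m) (u : Fin (m + 1)) :
    ∃ c, Win false c m false {cells ∅ {u}} ∧ m ≤ 2 * c + 4 * (m / 16) + 8 := by
  have hu : (u : ℕ) + (m - u) = m := by omega
  rw [cells_singleton_right]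
  generalize (u : ℕ) = i, m - (u : ℕ) = j at hu
  subst hu
  rcases Nat.even_or_odd i with hi | hi
  · have hj := (Nat.even_add.1 hm).1 hi
    rw [Nat.even_iff] at hm
    have hi' := Nat.even_iff.1 hi
    exact ⟨_, win_agree_append_some hi hj (win_agree hi) (win_agree hj), by omega⟩
  · have hj : Odd j := by grind
    obtain ⟨a, rfl⟩ : ∃ a, i = a + 1 := ⟨i - 1, by grind⟩
    obtain ⟨b, rfl⟩ : ∃ b, j = b + 1 := ⟨j - 1, by grind⟩
    have ha : Even a := by grind
    have hb : Even b := by grind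
    have ha' := Nat.even_iff.1 ha
    have hb' := Nat.even_iff.1 hb
    have := win_agree_append_none ha hb (win_agree ha) (win_agree hb)
    rw [show a + b + 2 = a + 1 + (b + 1) by ring] at this
    exact ⟨_, this, by omega⟩

lemma balI_pathGraph_even {n : ℕ} (hn : 1 ≤ n) (he : Even n) :
    2 * ((n / 16 : ℕ) : ℤ) - 5 ≤ balI (pathGraph n) ∧
      balI (pathGraph n) ≤ 4 * (((n + 15) / 16 : ℕ) : ℤ) - 1 := by
  obtain ⟨m, rfl⟩ : ∃ m, n = m + 1 := ⟨n - 1, by omega⟩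
  have hc : ((∅ : Finset (Fin (m + 1))) ∪ ∅)ᶜ.card = m + 1 := by simp
  have hl := le_gameVal_of_win (t := true) (by simp) hc (cells_empty ▸ win_differ he)
  have hl' := hl.trans (gameVal_true_le_false he hc)
  have hr := gameVal_le_of_win (t := false) (by simp) hc (cells_empty ▸ win_agree he)
  rw [Nat.even_iff] at he
  rw [balI, Fintype.card_fin]
  constructor <;> omega

lemma balI_pathGraph_odd {n : ℕ} (ho : Odd n) :
    2 * ((n / 16 : ℕ) : ℤ) ≤ balI (pathGraph n) ∧
      balI (pathGraph n) ≤ 4 * (((n + 15) / 16 : ℕ) : ℤ) + 4 := by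
  obtain ⟨m, rfl⟩ : ∃ m, n = m + 1 := ⟨n - 1, by grind⟩
  have hm : Even m := by grind
  have hne : ((∅ : Finset (Fin (m + 1))) ∪ ∅)ᶜ.Nonempty := by simp
  have hc : ∀ u : Fin (m + 1), ((∅ : Finset (Fin (m + 1))) ∪ {u})ᶜ.card = m := fun u => by
    simp [Finset.card_compl]
  rw [balI, Fintype.card_fin, le_gameVal_false_iff hne, gameVal_false_le_iff hne]
  simp only [insert_empty_eq]
  constructor
  · refine ⟨0, by simp, ?_⟩
    have hw : Win true (9 * (m / 16) + m % 16 / 2) m false {cells {(0 : Fin (m + 1))} ∅} := by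
      rw [cells_singleton_left, ← add_zero ({_} : Multiset Strip)]
      refine Win.of_cut (l := [some true]) ?_
      rw [add_assoc, add_zero]
      exact (win_differ hm).of_drop (u := [some true]) (by simp)
    have := le_gameVal_of_win (t := true) (by simp) (hc 0) hw
    rw [Nat.even_iff] at hm
    omega
  · intro u _
    obtain ⟨c, hw, hmc⟩ := win_agree_singleton hm u
    refine (gameVal_true_le_false hm (hc u)).trans ?_
    have := gameVal_le_of_win (t := false) (by simp) (hc u) hw
    omega

end PathBalance

theorem statement_16 (n : ℕ) (hn : 1 ≤ n) :
    (Even n →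
      2 * ((n / 16 : ℕ) : ℤ) - 5 ≤ balI (SimpleGraph.pathGraph n) ∧
      balI (SimpleGraph.pathGraph n) ≤ 4 * (((n + 15) / 16 : ℕ) : ℤ) - 1) ∧
    (Odd n →
      2 * ((n / 16 : ℕ) : ℤ) ≤ balI (SimpleGraph.pathGraph n) ∧
      balI (SimpleGraph.pathGraph n) ≤ 4 * (((n + 15) / 16 : ℕ) : ℤ) + 4) := by
  exact ⟨PathBalance.balI_pathGraph_even hn, PathBalance.balI_pathGraph_odd⟩
end

section
/- Let P_n denote the path graph on n vertices. There exists a real number c such that the sequence b^A_g(P_n)/n converges to c and the sequence b^I_g(P_n)/n converges to c as n → ∞. -/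
open SimpleGraph

/-- `SecuresLE f c t F S`: Admirable, already owning `S`, can secure a final payoff at most `c` when
the vertices in `F` remain, the payoff is `f` of her final set, and she moves next iff `t`. -/
inductive SecuresLE {V : Type*} [DecidableEq V] (f : Finset V → ℤ) (c : ℤ) :
    Bool → Finset V → Finset V → Prop
  | done {t : Bool} {F S : Finset V} (hF : F = ∅) (h : f S ≤ c) : SecuresLE f c t F S
  | admirable {F S : Finset V} (v : V) (hv : v ∈ F)
      (h : SecuresLE f c false (F.erase v) (insert v S)) : SecuresLE f c true F S
  | impish {F S : Finset V} (hF : F.Nonempty)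
      (h : ∀ v ∈ F, SecuresLE f c true (F.erase v) S) : SecuresLE f c false F S

namespace SecuresLE

section General

variable {V W : Type*} [DecidableEq V] [DecidableEq W] {f : Finset V → ℤ} {c : ℤ}
  {t : Bool} {F S : Finset V}

theorem payoff_le (h : SecuresLE f c t ∅ S) : f S ≤ c := by
  cases h with
  | done _ h => exact h
  | admirable v hv _ => simp at hv
  | impish hF _ => simp at hF

theorem exists_move (h : SecuresLE f c true F S) (hF : F.Nonempty) :
    ∃ v ∈ F, SecuresLE f c false (F.erase v) (insert v S) := by
  cases h with
  | done h0 _ => simp [h0] at hF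
  | admirable v hv h => exact ⟨v, hv, h⟩

theorem forall_move (h : SecuresLE f c false F S) {v : V} (hv : v ∈ F) :
    SecuresLE f c true (F.erase v) S := by
  cases h with
  | done h0 _ => simp [h0] at hv
  | impish _ h => exact h v hv

theorem exists_payoff_le (h : SecuresLE f c t F S) : ∃ T, f T ≤ c := by
  induction h with
  | done _ h => exact ⟨_, h⟩
  | admirable _ _ _ ih => exact ih
  | impish hF _ ih => exact ih _ hF.choose_spec

theorem transfer (h : SecuresLE f c t F S) {f' : Finset W → ℤ} {d : ℤ} {φ : V → W}
    {F' S' : Finset W} (hφ : Set.InjOn φ F) (hF' : F.image φ = F')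
    (hf : ∀ T ⊆ F, f' (S' ∪ T.image φ) ≤ f (S ∪ T) + d) :
    SecuresLE f' (c + d) t F' S' := by
  have herase : ∀ {F : Finset V} {v}, Set.InjOn φ F → v ∈ F →
      (F.erase v).image φ = (F.image φ).erase (φ v) := by
    intro F v hφ hv
    ext y
    simp only [Finset.mem_image, Finset.mem_erase]
    constructor
    · rintro ⟨x, ⟨hx, hxF⟩, rfl⟩
      exact ⟨fun h => hx (hφ hxF hv h), x, hxF, rfl⟩
    · rintro ⟨hy, x, hxF, rfl⟩
      exact ⟨x, ⟨fun h => hy (h ▸ rfl), hxF⟩, rfl⟩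
  subst hF'
  induction h generalizing S' with
  | @done t F S hF h =>
    refine done (by simp [hF]) ?_
    have := hf ∅ (by simp)
    simp only [Finset.image_empty, Finset.union_empty] at this
    omega
  | @admirable F S v hv h ih =>
    refine admirable (φ v) (Finset.mem_image_of_mem φ hv) ?_
    rw [← herase hφ hv]
    refine ih (hφ.mono (by simp)) fun T hT => ?_
    have := hf (insert v T) (Finset.insert_subset hv (hT.trans (Finset.erase_subset _ _)))
    simpa [Finset.image_insert] using this
  | @impish F S hF h ih =>
    refine impish (hF.image φ) fun w hw => ?_
    obtain ⟨v, hv, rfl⟩ := Finset.mem_image.1 hw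
    rw [← herase hφ hv]
    exact ih v hv (hφ.mono (by simp)) fun T hT => hf T (hT.trans (Finset.erase_subset _ _))

/-- Owning an extra vertex costs Admirable at most the largest marginal payoff of a vertex. -/
theorem insert_extra {d : ℤ} (hd : 0 ≤ d) (hf : ∀ v S, f (insert v S) ≤ f S + d)
    (h : SecuresLE f c t F S) {v : V} (hv : v ∈ F) :
    SecuresLE f (c + d) t (F.erase v) (insert v S) := by
  induction h generalizing v with
  | done hF _ => simp [hF] at hv
  | @admirable F S u hu h ih =>
    rcases eq_or_ne u v with rfl | huv
    · rcases (F.erase u).eq_empty_or_nonempty with h0 | ⟨w, hw⟩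
      · rw [h0] at h
        exact done h0 (h.payoff_le.trans (by omega))
      · exact admirable w hw (ih hw)
    · refine admirable u (Finset.mem_erase.2 ⟨huv, hu⟩) ?_
      rw [Finset.erase_right_comm, Finset.insert_comm]
      exact ih (Finset.mem_erase.2 ⟨huv.symm, hv⟩)
  | @impish F S hF h ih =>
    rcases (F.erase v).eq_empty_or_nonempty with h0 | hne
    · have h1 := h v hv
      rw [h0] at h1
      have := h1.payoff_le
      exact done h0 ((hf v S).trans (by omega))
    · refine impish hne fun u hu => ?_
      rw [Finset.mem_erase] at hu
      rw [Finset.erase_right_comm]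
      exact ih u hu.2 (Finset.mem_erase.2 ⟨hu.1.symm, hv⟩)

/-- Strategy stealing: up to the marginal payoff of a vertex, moving first does not hurt. -/
theorem steal {d : ℤ} (hd : 0 ≤ d) (hf : ∀ v S, f (insert v S) ≤ f S + d)
    (h : SecuresLE f c false F S) : SecuresLE f (c + d) true F S := by
  rcases F.eq_empty_or_nonempty with rfl | ⟨v, hv⟩
  · exact done rfl (h.payoff_le.trans (by omega))
  · exact admirable v hv (h.insert_extra hd hf hv)

/-- Playing second on two boards of even size, Admirable can answer on the same board. -/
theorem union {f₁ f₂ : Finset V → ℤ} {c₁ c₂ d : ℤ} {F₁ F₂ S₁ S₂ : Finset V}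
    (h₁ : SecuresLE f₁ c₁ false F₁ S₁) (h₂ : SecuresLE f₂ c₂ false F₂ S₂)
    (he₁ : Even F₁.card) (he₂ : Even F₂.card) (hF : Disjoint F₁ F₂)
    (hf : ∀ T₁ ⊆ F₁, ∀ T₂ ⊆ F₂, f (S ∪ (T₁ ∪ T₂)) ≤ f₁ (S₁ ∪ T₁) + f₂ (S₂ ∪ T₂) + d) :
    SecuresLE f (c₁ + c₂ + d) false (F₁ ∪ F₂) S := by
  have answer : ∀ {f : Finset V → ℤ} {c : ℤ} {F S : Finset V}, SecuresLE f c false F S →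
      Even F.card → ∀ u ∈ F, ∃ w ∈ F.erase u,
        SecuresLE f c false ((F.erase u).erase w) (insert w S) ∧
        Even ((F.erase u).erase w).card ∧ ((F.erase u).erase w).card < F.card := by
    intro f c F S h he u hu
    have hc := Finset.card_erase_add_one hu
    obtain ⟨w, hw, h'⟩ := (h.forall_move hu).exists_move (Finset.card_pos.1 (by grind))
    have hc' := Finset.card_erase_add_one hw
    exact ⟨w, hw, h', by grind, by omega⟩
  induction hn : F₁.card + F₂.card using Nat.strong_induction_on
    generalizing F₁ F₂ S₁ S₂ S with
  | _ n ih =>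
  rcases (F₁ ∪ F₂).eq_empty_or_nonempty with h0 | hne
  · refine done h0 ?_
    obtain ⟨rfl, rfl⟩ := Finset.union_eq_empty.1 h0
    have := hf ∅ (by simp) ∅ (by simp)
    have := h₁.payoff_le
    have := h₂.payoff_le
    simp only [Finset.union_empty] at *
    omega
  · refine impish hne fun u hu => ?_
    rcases Finset.mem_union.1 hu with hu | hu
    · obtain ⟨w, hw, h', he', hlt⟩ := answer h₁ he₁ u hu
      have hsub : (F₁.erase u).erase w ⊆ F₁ :=
        (Finset.erase_subset _ _).trans (Finset.erase_subset _ _)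
      have hu₂ := Finset.disjoint_left.1 hF hu
      have hw₂ := Finset.disjoint_left.1 hF (Finset.mem_of_mem_erase hw)
      refine admirable w (Finset.mem_erase.2 ⟨Finset.ne_of_mem_erase hw,
        Finset.mem_union_left _ (Finset.mem_of_mem_erase hw)⟩) ?_
      rw [Finset.erase_union_distrib, Finset.erase_union_distrib, Finset.erase_eq_of_notMem hu₂,
        Finset.erase_eq_of_notMem hw₂]
      refine ih _ (by omega) h' h₂ he' he₂ (hF.mono_left hsub) (fun T₁ hT₁ T₂ hT₂ => ?_) rfl
      have := hf (insert w T₁)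
        (Finset.insert_subset (Finset.mem_of_mem_erase hw) (hT₁.trans hsub)) T₂ hT₂
      simpa using this
    · obtain ⟨w, hw, h', he', hlt⟩ := answer h₂ he₂ u hu
      have hsub : (F₂.erase u).erase w ⊆ F₂ :=
        (Finset.erase_subset _ _).trans (Finset.erase_subset _ _)
      have hu₁ := Finset.disjoint_right.1 hF hu
      have hw₁ := Finset.disjoint_right.1 hF (Finset.mem_of_mem_erase hw)
      refine admirable w (Finset.mem_erase.2 ⟨Finset.ne_of_mem_erase hw,
        Finset.mem_union_right _ (Finset.mem_of_mem_erase hw)⟩) ?_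
      rw [Finset.erase_union_distrib, Finset.erase_union_distrib, Finset.erase_eq_of_notMem hu₁,
        Finset.erase_eq_of_notMem hw₁]
      refine ih _ (by omega) h₁ h' he₁ he' (hF.mono_right hsub) (fun T₁ hT₁ T₂ hT₂ => ?_) rfl
      have := hf T₁ hT₁ (insert w T₂)
        (Finset.insert_subset (Finset.mem_of_mem_erase hw) (hT₂.trans hsub))
      simpa using this

end General

end SecuresLE

/-- The score of the path on the vertices `0, …, m` when Admirable owns `S`. -/
def pathScore (m : ℕ) (S : Finset ℕ) : ℤ :=
  ∑ i ∈ Finset.range m, if (i ∈ S ↔ i + 1 ∈ S) then -1 else 1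

theorem pathScore_succ (m : ℕ) (S : Finset ℕ) :
    pathScore (m + 1) S = pathScore m S + if (m ∈ S ↔ m + 1 ∈ S) then -1 else 1 :=
  Finset.sum_range_succ _ _

theorem pathScore_congr {m : ℕ} {S T : Finset ℕ} (h : ∀ i ≤ m, i ∈ S ↔ i ∈ T) :
    pathScore m S = pathScore m T := by
  refine Finset.sum_congr rfl fun i hi => ?_
  rw [Finset.mem_range] at hi
  simp only [h i hi.le, h (i + 1) hi]

theorem neg_le_pathScore (m : ℕ) (S : Finset ℕ) : -(m : ℤ) ≤ pathScore m S := by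
  induction m with
  | zero => simp [pathScore]
  | succ m ih => rw [pathScore_succ]; push_cast; split_ifs <;> omega

theorem pathScore_insert_le (m v : ℕ) (S : Finset ℕ) :
    pathScore m (insert v S) ≤ pathScore m S + 4 := by
  have key : ∀ m, pathScore m (insert v S) ≤
      pathScore m S + (if v ≤ m then 2 else 0) + (if v < m then 2 else 0) := by
    intro m
    induction m with
    | zero => simp only [pathScore]; split_ifs <;> simp
    | succ m ih =>
      rw [pathScore_succ, pathScore_succ]
      rcases lt_trichotomy v m with h | rfl | h
      · have h1 : m ∈ insert v S ↔ m ∈ S := by grind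
        have h2 : m + 1 ∈ insert v S ↔ m + 1 ∈ S := by grind
        simp only [h1, h2]
        grind
      · grind
      · by_cases h' : v = m + 1
        · grind
        · have h1 : m ∈ insert v S ↔ m ∈ S := by grind
          have h2 : m + 1 ∈ insert v S ↔ m + 1 ∈ S := by grind
          simp only [h1, h2]
          grind
  refine (key m).trans ?_
  split_ifs <;> omega

/-- Deleting a vertex of a path and joining its neighbours changes the score by at most `3`. -/
theorem abs_pathScore_sub_le {m v : ℕ} (hv : v ≤ m + 1) {S T : Finset ℕ}
    (h : ∀ i, i ∈ T ↔ (if i < v then i else i + 1) ∈ S) :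
    |pathScore m T - pathScore (m + 1) S| ≤ 3 := by
  induction m with
  | zero => simp only [pathScore]; simp; split_ifs <;> simp
  | succ m ih =>
    rw [pathScore_succ (m + 1)]
    by_cases h1 : v ≤ m
    · have e1 : m ∈ T ↔ m + 1 ∈ S := by rw [h, if_neg (by omega)]
      have e2 : m + 1 ∈ T ↔ m + 1 + 1 ∈ S := by rw [h, if_neg (by omega)]
      rw [pathScore_succ]
      simp only [e1, e2, add_sub_add_right_eq_sub]
      exact ih (by omega)
    · by_cases h2 : v = m + 1
      · have : pathScore m T = pathScore m S :=
          pathScore_congr fun i hi => by rw [h, if_pos (by omega)]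
        rw [pathScore_succ, pathScore_succ, this, abs_le]
        constructor <;> split_ifs <;> omega
      · have : pathScore (m + 1) T = pathScore (m + 1) S :=
          pathScore_congr fun i hi => by rw [h, if_pos (by omega)]
        rw [this, abs_le]
        constructor <;> split_ifs <;> omega

/-- `PathSecuresLE n t c`: Admirable can secure a score at most `c` on the path with `n` vertices,
moving first iff `t`. -/
def PathSecuresLE (n : ℕ) (t : Bool) (c : ℤ) : Prop :=
  SecuresLE (pathScore (n - 1)) c t (Finset.range n) ∅

namespace PathSecuresLE

theorem steal {n : ℕ} {c : ℤ} (h : PathSecuresLE n false c) : PathSecuresLE n true (c + 4) :=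
  SecuresLE.steal (by norm_num) (fun v S => pathScore_insert_le _ v S) h

theorem neg_le {n : ℕ} {t : Bool} {c : ℤ} (h : PathSecuresLE n t c) : -(n : ℤ) ≤ c := by
  obtain ⟨T, hT⟩ := SecuresLE.exists_payoff_le h
  have := neg_le_pathScore (n - 1) T
  omega

theorem of_succ {n : ℕ} {c : ℤ} (h : PathSecuresLE (n + 1) true c) :
    PathSecuresLE n false (c + 3) := by
  obtain ⟨v, hv, h'⟩ := SecuresLE.exists_move h (by simp)
  rw [Finset.mem_range] at hv
  refine h'.transfer (φ := fun i => if i < v then i else i - 1) ?_ ?_ ?_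
  · intro i hi j hj hij
    simp at hi hj hij
    grind
  · ext j
    simp only [Finset.mem_image, Finset.mem_erase, Finset.mem_range]
    constructor
    · grind
    · intro hj
      exact ⟨if j < v then j else j + 1, by grind, by grind⟩
  · intro T hT
    have hvT : v ∉ T := fun hvT => by simpa using hT hvT
    rcases n with _ | n
    · simp [pathScore]
    have := abs_le.1 (abs_pathScore_sub_le (m := n) (v := v) (by omega)
      (S := insert v ∅ ∪ T) (T := ∅ ∪ T.image fun i => if i < v then i else i - 1) (by
        intro i
        simp only [Finset.empty_union, Finset.mem_image, Finset.mem_union, insert_empty_eq,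
          Finset.mem_singleton]
        constructor
        · rintro ⟨j, hj, rfl⟩
          have : j ≠ v := fun h => hvT (h ▸ hj)
          right
          convert hj using 1
          grind
        · rintro (h | h)
          · grind
          · exact ⟨_, h, by grind⟩))
    simp only [Nat.add_sub_cancel]
    omega

theorem succ {n : ℕ} {c : ℤ} (h : PathSecuresLE n true c) :
    PathSecuresLE (n + 1) false (c + 3) := by
  refine SecuresLE.impish (by simp) fun v hv => ?_
  rw [Finset.mem_range] at hv
  refine h.transfer (φ := fun i => if i < v then i else i + 1) ?_ ?_ ?_
  · intro i _ j _ hij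
    simp at hij
    grind
  · ext j
    simp only [Finset.mem_image, Finset.mem_erase, Finset.mem_range]
    constructor
    · grind
    · intro hj
      exact ⟨if j < v then j else j - 1, by grind, by grind⟩
  · intro T hT
    rcases n with _ | n
    · simp [pathScore]
    have := abs_le.1 (abs_pathScore_sub_le (m := n) (v := v) (by omega)
      (T := ∅ ∪ T) (S := ∅ ∪ T.image fun i => if i < v then i else i + 1) (by
        intro i
        simp only [Finset.empty_union, Finset.mem_image]
        constructor
        · intro hi
          exact ⟨i, hi, rfl⟩
        · rintro ⟨j, hj, hij⟩
          convert hj using 1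
          grind))
    simp only [Nat.add_sub_cancel]
    omega

theorem add {m n : ℕ} {c d : ℤ} (hm : Even m) (hn : Even n) (h : PathSecuresLE m false c)
    (h' : PathSecuresLE n false d) : PathSecuresLE (m + n) false (c + d + 1) := by
  have h'' : SecuresLE (fun S => pathScore (n - 1) ((Finset.range n).filter (· + m ∈ S))) (d + 0)
      false ((Finset.range n).image (· + m)) ∅ := by
    refine h'.transfer (add_left_injective m).injOn rfl fun T hT => ?_
    rw [add_zero]
    refine (congrArg _ ?_).le
    ext i
    have := @hT i
    simp at this ⊢
    grind
  rw [add_zero] at h''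
  have hu : Finset.range (m + n) = Finset.range m ∪ (Finset.range n).image (· + m) := by
    ext i
    simp only [Finset.mem_range, Finset.mem_union, Finset.mem_image]
    constructor
    · intro hi
      by_cases h : i < m
      · exact Or.inl h
      · exact Or.inr ⟨i - m, by omega, by omega⟩
    · rintro (h | ⟨j, hj, rfl⟩) <;> omega
  rw [PathSecuresLE, hu]
  refine SecuresLE.union h h'' (by simpa using hm)
    (by rwa [Finset.card_image_of_injective _ (add_left_injective m), Finset.card_range])
    ?_ fun T₁ hT₁ T₂ hT₂ => ?_
  · rw [Finset.disjoint_left]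
    intro i hi hi'
    simp at hi hi'
    omega
  · simp only [Finset.empty_union]
    have h₁ : ∀ i, i ∈ T₁ → i < m := fun i hi => by simpa using hT₁ hi
    have h₂ : ∀ i, i ∈ T₂ → m ≤ i ∧ i < m + n := fun i hi => by
      have := hT₂ hi
      simp at this
      omega
    have key : ∀ k < n, pathScore (m + k) (T₁ ∪ T₂) ≤ pathScore (m - 1) T₁ +
        pathScore k ((Finset.range n).filter (· + m ∈ T₂)) + 1 := by
      intro k hk
      induction k with
      | zero =>
        rcases m with _ | m
        · simp [pathScore]
        · have : pathScore m (T₁ ∪ T₂) = pathScore m T₁ :=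
            pathScore_congr fun i hi => by grind
          rw [add_zero, pathScore_succ, this]
          simp only [pathScore, Finset.range_zero, Finset.sum_empty, Nat.add_sub_cancel]
          split_ifs <;> omega
      | succ k ih =>
        have := ih (by omega)
        rw [← add_assoc, pathScore_succ, pathScore_succ]
        have e₁ : m + k ∈ T₁ ∪ T₂ ↔ k ∈ (Finset.range n).filter (· + m ∈ T₂) := by grind
        have e₂ : m + k + 1 ∈ T₁ ∪ T₂ ↔ k + 1 ∈ (Finset.range n).filter (· + m ∈ T₂) := by grind
        simp only [e₁, e₂]
        omega
    rcases n with _ | n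
    · have hT : T₁ ∪ T₂ = T₁ := by grind
      rw [hT]
      simp [pathScore]
    · have := key n (by omega)
      rwa [Nat.add_sub_cancel, show m + (n + 1) - 1 = m + n by omega]

end PathSecuresLE

theorem bscore_pathGraph (n : ℕ) (S : Finset (Fin n)) :
    bscore (pathGraph n) (S : Set (Fin n)) (↑Sᶜ : Set (Fin n)) =
      pathScore (n - 1) (S.map Fin.valEmbedding) := by
  rcases n with _ | n
  · simp [bscore, pathScore, Subsingleton.elim (pathGraph 0) ⊥]
  let g : Fin n → Sym2 (Fin (n + 1)) := fun i => s(i.castSucc, i.succ)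
  have hg : Function.Injective g := by
    intro i j hij
    simp only [g, Sym2.eq_iff, Fin.ext_iff, Fin.val_castSucc, Fin.val_succ] at hij
    ext
    omega
  have hE : (pathGraph (n + 1)).edgeSet = Set.range g := by
    ext e
    induction e using Sym2.ind with
    | _ u v =>
      simp only [mem_edgeSet, pathGraph_adj, Set.mem_range, g, Sym2.eq_iff, Fin.ext_iff,
        Fin.val_castSucc, Fin.val_succ]
      constructor
      · rintro (h | h)
        · exact ⟨⟨u, by omega⟩, by simp; omega⟩
        · exact ⟨⟨v, by omega⟩, by simp; omega⟩
      · rintro ⟨i, hi⟩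
        omega
  have hcard : ∀ P : Sym2 (Fin (n + 1)) → Prop, ∀ [DecidablePred fun i => P (g i)],
      ({e ∈ (pathGraph (n + 1)).edgeSet | P e}.ncard : ℤ) =
        ∑ i : Fin n, if P (g i) then 1 else 0 := by
    intro P _
    have : {e ∈ (pathGraph (n + 1)).edgeSet | P e} =
        g '' (Finset.univ.filter fun i => P (g i) : Finset (Fin n)) := by
      ext e
      simp only [hE, Set.mem_ofPred_eq, Set.mem_range, Set.mem_image, Finset.coe_filter,
        Finset.mem_univ, true_and]
      constructor
      · rintro ⟨⟨i, rfl⟩, h⟩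
        exact ⟨i, h, rfl⟩
      · rintro ⟨i, h, rfl⟩
        exact ⟨⟨i, rfl⟩, h⟩
    rw [this, Set.ncard_image_of_injective _ hg, Set.ncard_coe_finset]
    simp
  classical
  rw [bscore, hcard, hcard, ← Finset.sum_sub_distrib, pathScore, Nat.add_sub_cancel,
    ← Fin.sum_univ_eq_sum_range
      (fun i => if (i ∈ S.map Fin.valEmbedding ↔ i + 1 ∈ S.map Fin.valEmbedding)
        then (-1 : ℤ) else 1)]
  refine Finset.sum_congr rfl fun i _ => ?_
  have e₁ : (i : ℕ) ∈ S.map Fin.valEmbedding ↔ i.castSucc ∈ S := by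
    rw [← Finset.mem_map' Fin.valEmbedding]; rfl
  have e₂ : (i : ℕ) + 1 ∈ S.map Fin.valEmbedding ↔ i.succ ∈ S := by
    rw [← Finset.mem_map' Fin.valEmbedding]; simp
  have e₃ : (∃ u ∈ (S : Set (Fin (n + 1))), ∃ v ∈ (↑Sᶜ : Set (Fin (n + 1))), g i = s(u, v)) ↔
      ¬(i.castSucc ∈ S ↔ i.succ ∈ S) := by
    simp only [g, Sym2.eq_iff, Finset.mem_coe, Finset.mem_compl]
    grind
  have e₄ : ((∃ u ∈ (S : Set (Fin (n + 1))), ∃ v ∈ (S : Set (Fin (n + 1))), g i = s(u, v)) ∨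
      (∃ u ∈ (↑Sᶜ : Set (Fin (n + 1))), ∃ v ∈ (↑Sᶜ : Set (Fin (n + 1))), g i = s(u, v))) ↔
      (i.castSucc ∈ S ↔ i.succ ∈ S) := by
    simp only [g, Sym2.eq_iff, Finset.mem_coe, Finset.mem_compl]
    grind
  simp only [e₁, e₂, e₃, e₄]
  split_ifs <;> simp_all

theorem gameVal_succ {V : Type*} [Fintype V] [inst : DecidableEq V] (G : SimpleGraph V) (k : ℕ)
    (t : Bool) (S₀ S₁ : Finset V) :
    gameVal G (k + 1) t S₀ S₁ =
      if h : (Finset.univ \ (S₀ ∪ S₁)).Nonempty then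
        if t then (Finset.univ \ (S₀ ∪ S₁)).inf' h fun v => gameVal G k false (insert v S₀) S₁
        else (Finset.univ \ (S₀ ∪ S₁)).sup' h fun v => gameVal G k true S₀ (insert v S₁)
      else bscore G S₀ S₁ := by
  obtain rfl : inst = Classical.decEq V := Subsingleton.elim _ _
  rw [gameVal]

theorem gameVal_pathGraph_le_iff {n : ℕ} {c : ℤ} (k : ℕ) (t : Bool) (S₀ S₁ : Finset (Fin n))
    (hS : Disjoint S₀ S₁) (hk : (Finset.univ \ (S₀ ∪ S₁)).card = k) :
    gameVal (pathGraph n) k t S₀ S₁ ≤ c ↔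
      SecuresLE (pathScore (n - 1)) c t ((Finset.univ \ (S₀ ∪ S₁)).map Fin.valEmbedding)
        (S₀.map Fin.valEmbedding) := by
  induction k generalizing t S₀ S₁ with
  | zero =>
    have h0 := Finset.card_eq_zero.1 hk
    have hc : S₁ = S₀ᶜ := by
      ext x
      have := Finset.ext_iff.1 h0 x
      have h2 : x ∈ S₀ → x ∉ S₁ := fun hx => Finset.disjoint_left.1 hS hx
      simp at this ⊢
      tauto
    rw [h0, gameVal, hc, bscore_pathGraph]
    exact ⟨fun h => .done (by simp) h, fun h => SecuresLE.payoff_le h⟩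
  | succ k ih =>
    have hne : (Finset.univ \ (S₀ ∪ S₁)).Nonempty := Finset.card_pos.1 (by omega)
    have hA : ∀ v ∈ Finset.univ \ (S₀ ∪ S₁),
        (Finset.univ \ (S₀ ∪ S₁)).erase v = Finset.univ \ (insert v S₀ ∪ S₁) := by
      intro v hv
      grind
    have hI : ∀ v ∈ Finset.univ \ (S₀ ∪ S₁),
        (Finset.univ \ (S₀ ∪ S₁)).erase v = Finset.univ \ (S₀ ∪ insert v S₁) := by
      intro v hv
      grind
    have hcard : ∀ v ∈ Finset.univ \ (S₀ ∪ S₁),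
        ((Finset.univ \ (S₀ ∪ S₁)).erase v).card = k := by
      intro v hv
      rw [Finset.card_erase_of_mem hv, hk, Nat.add_sub_cancel]
    rw [gameVal_succ, dif_pos hne]
    cases t with
    | true =>
      simp only [if_true]
      rw [Finset.inf'_le_iff]
      have step : ∀ v ∈ Finset.univ \ (S₀ ∪ S₁),
          (gameVal (pathGraph n) k false (insert v S₀) S₁ ≤ c ↔
            SecuresLE (pathScore (n - 1)) c false
              (((Finset.univ \ (S₀ ∪ S₁)).map Fin.valEmbedding).erase (Fin.valEmbedding v))
              (insert (Fin.valEmbedding v) (S₀.map Fin.valEmbedding))) := by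
        intro v hv
        rw [← Finset.map_erase, ← Finset.map_insert, hA v hv]
        exact ih _ _ _ (by rw [Finset.disjoint_insert_left]; grind)
          (by rw [← hA v hv, hcard v hv])
      constructor
      · rintro ⟨v, hv, h⟩
        exact .admirable _ (Finset.mem_map_of_mem _ hv) ((step v hv).1 h)
      · intro h
        obtain ⟨w, hw, h⟩ := h.exists_move (by simpa using hne)
        obtain ⟨v, hv, rfl⟩ := Finset.mem_map.1 hw
        exact ⟨v, hv, (step v hv).2 h⟩
    | false =>
      simp only [Bool.false_eq_true, if_false]
      rw [Finset.sup'_le_iff]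
      have step : ∀ v ∈ Finset.univ \ (S₀ ∪ S₁),
          (gameVal (pathGraph n) k true S₀ (insert v S₁) ≤ c ↔
            SecuresLE (pathScore (n - 1)) c true
              (((Finset.univ \ (S₀ ∪ S₁)).map Fin.valEmbedding).erase (Fin.valEmbedding v))
              (S₀.map Fin.valEmbedding)) := by
        intro v hv
        rw [← Finset.map_erase, hI v hv]
        exact ih _ _ _ (by rw [Finset.disjoint_insert_right]; grind)
          (by rw [← hI v hv, hcard v hv])
      constructor
      · intro h
        refine .impish (by simpa using hne) fun w hw => ?_
        obtain ⟨v, hv, rfl⟩ := Finset.mem_map.1 hw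
        exact (step v hv).1 (h v hv)
      · intro h v hv
        exact (step v hv).2 (h.forall_move (Finset.mem_map_of_mem _ hv))

theorem gameVal_pathGraph_empty_le_iff {n : ℕ} {t : Bool} {c : ℤ} :
    gameVal (pathGraph n) (Fintype.card (Fin n)) t ∅ ∅ ≤ c ↔ PathSecuresLE n t c := by
  rw [gameVal_pathGraph_le_iff _ _ _ _ (by simp) (by simp), PathSecuresLE]
  have : (Finset.univ \ (∅ ∪ ∅) : Finset (Fin n)).map Fin.valEmbedding = Finset.range n := by
    ext i
    simp
  rw [this, Finset.map_empty]

theorem balA_pathGraph_le_iff {n : ℕ} {c : ℤ} :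
    balA (pathGraph n) ≤ c ↔ PathSecuresLE n true c :=
  gameVal_pathGraph_empty_le_iff

theorem balI_pathGraph_le_iff {n : ℕ} {c : ℤ} :
    balI (pathGraph n) ≤ c ↔ PathSecuresLE n false c :=
  gameVal_pathGraph_empty_le_iff

theorem balA_pathGraph_le_balI_add (n : ℕ) : balA (pathGraph n) ≤ balI (pathGraph n) + 4 :=
  balA_pathGraph_le_iff.2 (balI_pathGraph_le_iff.1 le_rfl).steal

theorem balI_pathGraph_le_balA_succ_add (n : ℕ) :
    balI (pathGraph n) ≤ balA (pathGraph (n + 1)) + 3 :=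
  balI_pathGraph_le_iff.2 (balA_pathGraph_le_iff.1 le_rfl).of_succ

theorem balI_pathGraph_succ_le_balA_add (n : ℕ) :
    balI (pathGraph (n + 1)) ≤ balA (pathGraph n) + 3 :=
  balI_pathGraph_le_iff.2 (balA_pathGraph_le_iff.1 le_rfl).succ

theorem balI_pathGraph_add_le {m n : ℕ} (hm : Even m) (hn : Even n) :
    balI (pathGraph (m + n)) ≤ balI (pathGraph m) + balI (pathGraph n) + 1 :=
  balI_pathGraph_le_iff.2 (.add hm hn (balI_pathGraph_le_iff.1 le_rfl)
    (balI_pathGraph_le_iff.1 le_rfl))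

theorem neg_le_balI_pathGraph (n : ℕ) : -(n : ℤ) ≤ balI (pathGraph n) :=
  (balI_pathGraph_le_iff.1 le_rfl).neg_le

theorem tendsto_div_nat_zero_of_abs_le {r : ℕ → ℝ} {C : ℝ} (h : ∀ n, |r n| ≤ C) :
    Filter.Tendsto (fun n : ℕ => r n / n) Filter.atTop (nhds 0) := by
  refine squeeze_zero_norm (fun n => ?_) (tendsto_const_div_atTop_nhds_zero_nat C)
  rw [norm_div, Real.norm_natCast, Real.norm_eq_abs]
  exact div_le_div_of_nonneg_right (h n) n.cast_nonneg

theorem exists_tendsto_balI_pathGraph_div : ∃ c : ℝ,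
    Filter.Tendsto (fun n : ℕ => (balI (pathGraph n) : ℝ) / n) Filter.atTop (nhds c) := by
  let u : ℕ → ℝ := fun k => balI (pathGraph (2 * k)) + 1
  have hu : Subadditive u := by
    intro m n
    have := balI_pathGraph_add_le (even_two_mul m) (even_two_mul n)
    rw [← mul_add] at this
    have : (balI (pathGraph (2 * (m + n))) : ℝ) ≤
        balI (pathGraph (2 * m)) + balI (pathGraph (2 * n)) + 1 := by exact_mod_cast this
    simp only [u]
    linarith
  have hbdd : BddBelow (Set.range fun n => u n / n) := by
    refine ⟨-2, ?_⟩
    rintro _ ⟨k, rfl⟩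
    have : (-((2 * k : ℕ) : ℤ) : ℝ) ≤ balI (pathGraph (2 * k)) := by
      exact_mod_cast neg_le_balI_pathGraph (2 * k)
    push_cast at this
    rcases k.eq_zero_or_pos with rfl | hk
    · simp
    · have hk' : (0 : ℝ) < k := by exact_mod_cast hk
      simp only [u]
      rw [le_div_iff₀ hk']
      linarith
  have hhalf : Filter.Tendsto (fun n : ℕ => n / 2) Filter.atTop Filter.atTop :=
    Filter.tendsto_atTop_atTop.2 fun b => ⟨2 * b, fun n hn => by omega⟩
  have h₁ := (hu.tendsto_lim hbdd).comp hhalf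
  have h₂ : Filter.Tendsto (fun n : ℕ => ((n / 2 : ℕ) : ℝ) / n) Filter.atTop
      (nhds (1 / 2)) := by
    have hr : ∀ n : ℕ, |-((n % 2 : ℕ) : ℝ) / 2| ≤ 1 := by
      intro n
      rcases Nat.mod_two_eq_zero_or_one n with h | h <;> rw [h] <;> norm_num [abs_le]
    have := (tendsto_div_nat_zero_of_abs_le hr).const_add (1 / 2)
    rw [add_zero] at this
    refine this.congr' ?_
    filter_upwards [Filter.eventually_gt_atTop 0] with n hn
    have hn' : (n : ℝ) ≠ 0 := by positivity
    have hdm : (2 : ℝ) * ((n / 2 : ℕ) : ℝ) + ((n % 2 : ℕ) : ℝ) = n := by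
      exact_mod_cast Nat.div_add_mod n 2
    field_simp
    linarith
  have h₃ : Filter.Tendsto (fun n : ℕ => ((balI (pathGraph n) : ℝ) - u (n / 2)) / n)
      Filter.atTop (nhds 0) := by
    refine tendsto_div_nat_zero_of_abs_le (C := 8) fun n => ?_
    have hint : |balI (pathGraph n) - (balI (pathGraph (2 * (n / 2))) + 1)| ≤ 8 := by
      have hn := Nat.div_add_mod n 2
      rcases Nat.mod_two_eq_zero_or_one n with h | h
      · rw [show 2 * (n / 2) = n by omega, abs_le]
        constructor <;> omega
      · have e : n = 2 * (n / 2) + 1 := by omega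
        generalize 2 * (n / 2) = m at *
        subst e
        have := balI_pathGraph_succ_le_balA_add m
        have := balA_pathGraph_le_balI_add m
        have := balI_pathGraph_le_balA_succ_add m
        have := balA_pathGraph_le_balI_add (m + 1)
        rw [abs_le]
        constructor <;> omega
    simp only [u]
    exact_mod_cast hint
  refine ⟨_, ((h₁.mul h₂).add h₃).congr' ?_⟩
  filter_upwards [Filter.eventually_ge_atTop 2] with n hn
  have hk : ((n / 2 : ℕ) : ℝ) ≠ 0 := by
    have : n / 2 ≠ 0 := by omega
    exact_mod_cast this
  simp only [Function.comp_apply]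
  rw [div_mul_div_cancel₀ hk, ← add_div]
  congr 1
  ring

theorem statement_18 : ∃ c : ℝ,
    Filter.Tendsto (fun n : ℕ => (balA (SimpleGraph.pathGraph n) : ℝ) / n)
      Filter.atTop (nhds c) ∧
    Filter.Tendsto (fun n : ℕ => (balI (SimpleGraph.pathGraph n) : ℝ) / n)
      Filter.atTop (nhds c) := by
  obtain ⟨c, hc⟩ := exists_tendsto_balI_pathGraph_div
  refine ⟨c, ?_, hc⟩
  have hdiff : ∀ n : ℕ, |(balA (pathGraph n) : ℝ) - balI (pathGraph n)| ≤ 10 := by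
    intro n
    have h₁ := balA_pathGraph_le_balI_add n
    have h₂ := balI_pathGraph_le_balA_succ_add n
    have h₃ := balA_pathGraph_le_balI_add (n + 1)
    have h₄ := balI_pathGraph_succ_le_balA_add n
    have : |balA (pathGraph n) - balI (pathGraph n)| ≤ 10 := by
      rw [abs_le]
      constructor <;> omega
    exact_mod_cast this
  have := hc.add (tendsto_div_nat_zero_of_abs_le hdiff)
  rw [add_zero] at this
  refine this.congr fun n => ?_
  rw [← add_div]
  congr 1
  ring
end
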